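/- Let A be a gentle algebra of rank n. Then every pre-tilting A-module M has at most n pairwise non-isomorphic indecomposable direct summands. -/

import Mathlib

open CategoryTheory

universe u

/-- The combinatorial data of a gentle presentation: a finite quiver together with a
set of relations given by composable paths of length two, satisfying the gentle
conditions. -/
structure GentleQuiverData : Type (u + 1) where
  /-- vertices -/
  V : Type u
  /-- arrows -/
  E : Type u
  fintV : Fintype V
  fintE : Fintype E
  /-- source -/
  src : E → V
  /-- target -/
  tgt : E → V
  /-- `rel a b` means that the length-two path `ab` is one of the generating relations -/
  rel : E → E → Prop
  rel_comp : ∀ a b, rel a b → tgt a = src b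
  src_le_two : ∀ v : V, Set.ncard {a : E | src a = v} ≤ 2
  tgt_le_two : ∀ v : V, Set.ncard {a : E | tgt a = v} ≤ 2
  rel_right_unique : ∀ a b c, rel a b → rel a c → b = c
  rel_left_unique : ∀ a b c, rel b a → rel c a → b = c
  nonrel_right_unique : ∀ a b c, tgt a = src b → ¬ rel a b → tgt a = src c → ¬ rel a c → b = c
  nonrel_left_unique : ∀ a b c, tgt b = src a → ¬ rel b a → tgt c = src a → ¬ rel c a → b = c

attribute [instance] GentleQuiverData.fintV GentleQuiverData.fintE

/-- The quiver is connected. -/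
def GentleQuiverData.Connected (Q : GentleQuiverData.{u}) : Prop :=
  ∀ v w : Q.V, Relation.ReflTransGen
    (fun x y => ∃ a : Q.E, (Q.src a = x ∧ Q.tgt a = y) ∨ (Q.src a = y ∧ Q.tgt a = x)) v w

variable (k : Type u) [Field k]

/-- The relations presenting the gentle algebra `kQ/I` as a quotient of the free algebra
on vertices and arrows: the vertices are orthogonal idempotents summing to `1`, arrows are
compatible with sources and targets, and the chosen length-two paths vanish. -/
inductive GentleRel (Q : GentleQuiverData.{u}) :
    FreeAlgebra k (Q.V ⊕ Q.E) → FreeAlgebra k (Q.V ⊕ Q.E) → Prop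
  | idem (v : Q.V) :
      GentleRel Q (FreeAlgebra.ι k (Sum.inl v) * FreeAlgebra.ι k (Sum.inl v))
        (FreeAlgebra.ι k (Sum.inl v))
  | orth (v w : Q.V) : v ≠ w →
      GentleRel Q (FreeAlgebra.ι k (Sum.inl v) * FreeAlgebra.ι k (Sum.inl w)) 0
  | sum_idem :
      GentleRel Q (∑ v : Q.V, FreeAlgebra.ι k (Sum.inl v)) 1
  | src_mul (a : Q.E) :
      GentleRel Q (FreeAlgebra.ι k (Sum.inl (Q.src a)) * FreeAlgebra.ι k (Sum.inr a))
        (FreeAlgebra.ι k (Sum.inr a))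
  | mul_tgt (a : Q.E) :
      GentleRel Q (FreeAlgebra.ι k (Sum.inr a) * FreeAlgebra.ι k (Sum.inl (Q.tgt a)))
        (FreeAlgebra.ι k (Sum.inr a))
  | relation (a b : Q.E) : Q.rel a b →
      GentleRel Q (FreeAlgebra.ι k (Sum.inr a) * FreeAlgebra.ι k (Sum.inr b)) 0

/-- The gentle algebra `kQ/I` associated to gentle quiver data. -/
abbrev GentleAlg (Q : GentleQuiverData.{u}) : Type u := RingQuot (GentleRel k Q)

section Modules

variable {B : Type u} [Ring B]

/-- `X` belongs to `add T`: it is a direct summand of a finite direct sum of copies of `T`. -/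
def MemAdd (T X : ModuleCat.{u} B) : Prop :=
  ∃ (n : ℕ) (f : X →ₗ[B] (Fin n → T)) (g : (Fin n → T) →ₗ[B] X), g.comp f = LinearMap.id

/-- An indecomposable module: nonzero, and any direct sum decomposition is trivial. -/
def IsIndec (X : ModuleCat.{u} B) : Prop :=
  Nontrivial X ∧ ∀ Y Z : ModuleCat.{u} B,
    Nonempty (X ≃ₗ[B] Y × Z) → Subsingleton Y ∨ Subsingleton Z

/-- `M` decomposes as the direct sum of the family `N` of pairwise non-isomorphic
indecomposable modules; in particular `M` is multiplicity-free. -/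
def IsIndecDecomp (M : ModuleCat.{u} B) {m : ℕ} (N : Fin m → ModuleCat.{u} B) : Prop :=
  (∀ i, IsIndec (N i)) ∧
  (∀ i j, i ≠ j → IsEmpty (N i ≃ₗ[B] N j)) ∧
  Nonempty (M ≃ₗ[B] ((i : Fin m) → N i))

/-- `M` is multiplicity-free with exactly `m` pairwise non-isomorphic indecomposable
direct summands. -/
def HasRank (M : ModuleCat.{u} B) (m : ℕ) : Prop :=
  ∃ N : Fin m → ModuleCat.{u} B, IsIndecDecomp M N

/-- Projective dimension at most `d`held via an explicit projective resolution. -/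
def ProjDimLE : ModuleCat.{u} B → ℕ → Prop
  | X, 0 => Module.Projective B X
  | X, (d + 1) => ∃ P : ModuleCat.{u} B, Module.Projective B P ∧
      ∃ f : P →ₗ[B] X, Function.Surjective f ∧ ProjDimLE (ModuleCat.of B (LinearMap.ker f)) d

/-- (T1): finite projective dimension. -/
def HasFiniteProjDim (X : ModuleCat.{u} B) : Prop := ∃ d, ProjDimLE X d

/-- There is an exact sequence `0 → X → T₀ → ⋯ → T_d → 0` with all `Tᵢ` in `add T`. -/
def CoresolvedBy (T : ModuleCat.{u} B) : ModuleCat.{u} B → ℕ → Prop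
  | X, 0 => MemAdd T X
  | X, (d + 1) => ∃ T₀ : ModuleCat.{u} B, MemAdd T T₀ ∧
      ∃ f : X →ₗ[B] T₀, Function.Injective f ∧
        CoresolvedBy T (ModuleCat.of B (T₀ ⧸ LinearMap.range f)) d

/-- The Ext-group `Ext^n_B(X, Y)`. -/
noncomputable def ExtGroup (X Y : ModuleCat.{u} B) (n : ℕ) : Type (u + 1) :=
  letI : HasDerivedCategory.{u + 1} (ModuleCat.{u} B) := HasDerivedCategory.standard _
  letI : HasExt.{u + 1} (ModuleCat.{u} B) := hasExt_of_hasDerivedCategory _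
  Abelian.Ext X Y n

/-- (T2): `Ext^i(T, T) = 0` for all `i > 0`. -/
def SelfOrthogonal (T : ModuleCat.{u} B) : Prop :=
  ∀ i : ℕ, 0 < i → Subsingleton (ExtGroup T T i)

/-- Pre-tilting: (T1) and (T2). -/
def IsPreTilting (T : ModuleCat.{u} B) : Prop :=
  HasFiniteProjDim T ∧ SelfOrthogonal T

/-- Tilting: (T1), (T2) and (T3) (an `add T`-coresolution of the regular module). -/
def IsTilting (T : ModuleCat.{u} B) : Prop :=
  HasFiniteProjDim T ∧ SelfOrthogonal T ∧ ∃ d, CoresolvedBy T (ModuleCat.of B B) d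

/-- The direct sum `M ⊕ N`. -/
def dSum (M N : ModuleCat.{u} B) : ModuleCat.{u} B := ModuleCat.of B (M × N)

/-- `N` is an (indecomposable) complement to `M`: a finite-dimensional indecomposable module
not in `add M` such that `M ⊕ N` is a tilting module. -/
def IsComplement (M N : ModuleCat.{u} B) : Prop :=
  Module.Finite B N ∧ IsIndec N ∧ ¬ MemAdd M N ∧ IsTilting (dSum M N)

end Modules

section

open MulOpposite

namespace GentleQuiverData

variable {k} {Q : GentleQuiverData.{u}}

section Generators

variable (k)

/-- The idempotent of the gentle algebra attached to a vertex. -/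
def vtx (v : Q.V) : GentleAlg k Q :=
  RingQuot.mkAlgHom k (GentleRel k Q) (FreeAlgebra.ι k (Sum.inl v))

/-- The element of the gentle algebra attached to an arrow. -/
def arr (α : Q.E) : GentleAlg k Q :=
  RingQuot.mkAlgHom k (GentleRel k Q) (FreeAlgebra.ι k (Sum.inr α))

lemma vtx_mul_self (v : Q.V) : vtx k v * vtx k v = vtx k v := by
  simpa [vtx] using RingQuot.mkAlgHom_rel k (GentleRel.idem (k := k) v)

lemma vtx_mul_of_ne {v w : Q.V} (h : v ≠ w) : vtx k v * vtx k w = 0 := by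
  simpa [vtx] using RingQuot.mkAlgHom_rel k (GentleRel.orth (k := k) v w h)

lemma sum_vtx : ∑ v : Q.V, vtx k v = 1 := by
  simpa [vtx] using RingQuot.mkAlgHom_rel k (GentleRel.sum_idem (k := k) (Q := Q))

lemma vtx_src_mul_arr (α : Q.E) : vtx k (Q.src α) * arr k α = arr k α := by
  simpa [vtx, arr] using RingQuot.mkAlgHom_rel k (GentleRel.src_mul (k := k) α)

lemma arr_mul_vtx_tgt (α : Q.E) : arr k α * vtx k (Q.tgt α) = arr k α := by
  simpa [vtx, arr] using RingQuot.mkAlgHom_rel k (GentleRel.mul_tgt (k := k) α)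

lemma arr_mul_arr {α β : Q.E} (h : Q.rel α β) : arr k α * arr k β = 0 := by
  simpa [vtx, arr] using RingQuot.mkAlgHom_rel k (GentleRel.relation (k := k) α β h)

end Generators

/-- Induction principle for the gentle algebra. -/
lemma gentleAlg_induction {motive : GentleAlg k Q → Prop}
    (scalar : ∀ c : k, motive (algebraMap k _ c))
    (vertex : ∀ v, motive (vtx k v)) (arrow : ∀ α, motive (arr k α))
    (mul : ∀ x y, motive x → motive y → motive (x * y))
    (add : ∀ x y, motive x → motive y → motive (x + y)) (x : GentleAlg k Q) : motive x := by
  obtain ⟨x, rfl⟩ := RingQuot.mkAlgHom_surjective k (GentleRel k Q) x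
  induction x using FreeAlgebra.induction with
  | grade0 c => simpa using scalar c
  | grade1 x =>
    cases x with
    | inl v => exact vertex v
    | inr α => exact arrow α
  | mul x y hx hy => simpa using mul _ _ hx hy
  | add x y hx hy => simpa using add _ _ hx hy

/-- Linear endomorphisms of a vector space that satisfy the relations of the gentle algebra,
written for a right action. -/
structure IsRep (Q : GentleQuiverData.{u}) {X : Type*} [AddCommGroup X] [Module k X]
    (e : Q.V → Module.End k X) (f : Q.E → Module.End k X) : Prop where
  idem : ∀ v x, e v (e v x) = e v x
  orth : ∀ v w x, v ≠ w → e w (e v x) = 0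
  sum_apply : ∀ x, ∑ v, e v x = x
  src_apply : ∀ α x, f α (e (Q.src α) x) = f α x
  tgt_apply : ∀ α x, e (Q.tgt α) (f α x) = f α x
  rel_apply : ∀ α β x, Q.rel α β → f β (f α x) = 0

namespace IsRep

variable {X : Type*} [AddCommGroup X] [Module k X] {e : Q.V → Module.End k X}
  {f : Q.E → Module.End k X}

lemma lift_aux (h : IsRep Q e f) ⦃x y : FreeAlgebra k (Q.V ⊕ Q.E)⦄ (hxy : GentleRel k Q x y) :
    FreeAlgebra.lift k (Sum.elim (fun v => op (e v)) (fun α => op (f α))) x =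
      FreeAlgebra.lift k (Sum.elim (fun v => op (e v)) (fun α => op (f α))) y := by
  apply unop_injective
  ext z
  cases hxy with
  | idem v => simpa using h.idem v z
  | orth v w hvw => simpa using h.orth v w z hvw
  | sum_idem => simpa using h.sum_apply z
  | src_mul α => simpa using h.src_apply α z
  | mul_tgt α => simpa using h.tgt_apply α z
  | relation α β hr => simpa using h.rel_apply α β z hr

/-- The action of the opposite gentle algebra defined by a representation. -/
noncomputable def toAlgHom (h : IsRep Q e f) : (GentleAlg k Q)ᵐᵒᵖ →ₐ[k] Module.End k X :=
  AlgHom.opComm (RingQuot.liftAlgHom k ⟨_, h.lift_aux⟩)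

@[simp] lemma toAlgHom_vtx (h : IsRep Q e f) (v : Q.V) : h.toAlgHom (op (vtx k v)) = e v := by
  simp [toAlgHom, vtx]

@[simp] lemma toAlgHom_arr (h : IsRep Q e f) (α : Q.E) : h.toAlgHom (op (arr k α)) = f α := by
  simp [toAlgHom, arr]

end IsRep

section ModuleAction

variable (k) (X : Type*) [AddCommGroup X] [Module k X] [Module (GentleAlg k Q)ᵐᵒᵖ X]
  [IsScalarTower k (GentleAlg k Q)ᵐᵒᵖ X]

/-- The action of a vertex idempotent on a right module. -/
noncomputable def vact (v : Q.V) : Module.End k X := Algebra.lsmul k k X (op (vtx k v))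

/-- The action of an arrow on a right module. -/
noncomputable def aact (α : Q.E) : Module.End k X := Algebra.lsmul k k X (op (arr k α))

variable {X}

lemma vact_apply (v : Q.V) (x : X) : vact k X v x = op (vtx k v) • x := rfl

lemma aact_apply (α : Q.E) (x : X) : aact k X α x = op (arr k α) • x := rfl

variable (X)

lemma isRep : IsRep Q (vact (Q := Q) k X) (aact (Q := Q) k X) where
  idem v x := by simp only [vact_apply, smul_smul, ← op_mul, vtx_mul_self]
  orth v w x h := by simp only [vact_apply, smul_smul, ← op_mul, vtx_mul_of_ne k h]; simp
  sum_apply x := by simp only [vact_apply, ← Finset.sum_smul, ← Finset.op_sum, sum_vtx]; simp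
  src_apply α x := by simp only [vact_apply, aact_apply, smul_smul, ← op_mul, vtx_src_mul_arr]
  tgt_apply α x := by simp only [vact_apply, aact_apply, smul_smul, ← op_mul, arr_mul_vtx_tgt]
  rel_apply α β x h := by simp only [aact_apply, smul_smul, ← op_mul, arr_mul_arr k h]; simp

variable {X} {Y : Type*} [AddCommGroup Y] [Module k Y] [Module (GentleAlg k Q)ᵐᵒᵖ Y]
  [IsScalarTower k (GentleAlg k Q)ᵐᵒᵖ Y]

lemma map_vact (f : X →ₗ[(GentleAlg k Q)ᵐᵒᵖ] Y) (v : Q.V) (x : X) :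
    f (vact k X v x) = vact k Y v (f x) := f.map_smul _ _

lemma map_aact (f : X →ₗ[(GentleAlg k Q)ᵐᵒᵖ] Y) (α : Q.E) (x : X) :
    f (aact k X α x) = aact k Y α (f x) := f.map_smul _ _

variable {k}

/-- A linear map that commutes with vertices and arrows commutes with the algebra. -/
lemma map_smul_of_comm (f : X →ₗ[k] Y) (hv : ∀ (v : Q.V) x, f (vact k X v x) = vact k Y v (f x))
    (ha : ∀ (α : Q.E) x, f (aact k X α x) = aact k Y α (f x)) (a : (GentleAlg k Q)ᵐᵒᵖ) (x : X) :
    f (a • x) = a • f x := by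
  induction a using MulOpposite.rec' with | _ a
  induction a using gentleAlg_induction generalizing x with
  | scalar c =>
    change f (algebraMap k (GentleAlg k Q)ᵐᵒᵖ c • x) = algebraMap k (GentleAlg k Q)ᵐᵒᵖ c • f x
    rw [algebraMap_smul, algebraMap_smul, map_smul]
  | vertex v => exact hv v x
  | arrow α => exact ha α x
  | mul a b iha ihb => rw [op_mul, mul_smul, mul_smul, ihb, iha]
  | add a b iha ihb => rw [MulOpposite.op_add, add_smul, add_smul, map_add, iha, ihb]

end ModuleAction

/-! ### The representation on paths -/

section Paths

/-- A path is recorded by its starting vertex and the list of its arrows, last arrow first. -/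
abbrev PathCode (Q : GentleQuiverData.{u}) : Type u := Q.V × List Q.E

/-- The terminal vertex of a path. -/
def PathCode.terminus : Q.PathCode → Q.V
  | (v, []) => v
  | (_, α :: _) => Q.tgt α

/-- The path `p` can be extended by the arrow `α` without running into a relation. -/
def PathCode.Extends : Q.PathCode → Q.E → Prop
  | (v, []), α => v = Q.src α
  | (_, β :: _), α => Q.tgt β = Q.src α ∧ ¬ Q.rel β α

/-- The path `p` followed by the arrow `α`. -/
def PathCode.snoc (p : Q.PathCode) (α : Q.E) : Q.PathCode := (p.1, α :: p.2)

lemma PathCode.snoc_injective (α : Q.E) :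
    Function.Injective (fun p : Q.PathCode => p.snoc α) := by
  rintro ⟨v, l⟩ ⟨w, m⟩ h
  simpa [PathCode.snoc] using h

lemma PathCode.Extends.end_eq {p : Q.PathCode} {α : Q.E} (h : p.Extends α) :
    p.terminus = Q.src α := by
  obtain ⟨v, _ | ⟨β, l⟩⟩ := p
  · exact h
  · exact h.1

open Classical in
/-- The action of a vertex on the space of paths. -/
noncomputable def pathVtx (v : Q.V) : Module.End k (Q.PathCode →₀ k) :=
  Finsupp.lsum k fun p => if p.terminus = v then Finsupp.lsingle p else 0

open Classical in
/-- The action of an arrow on the space of paths. -/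
noncomputable def pathArr (α : Q.E) : Module.End k (Q.PathCode →₀ k) :=
  Finsupp.lsum k fun p => if p.Extends α then Finsupp.lsingle (p.snoc α) else 0

open Classical in
lemma pathVtx_single (v : Q.V) (p : Q.PathCode) (c : k) :
    pathVtx v (Finsupp.single p c) = if p.terminus = v then Finsupp.single p c else 0 := by
  rw [pathVtx, Finsupp.lsum_single]
  split_ifs <;> simp

open Classical in
lemma pathArr_single (α : Q.E) (p : Q.PathCode) (c : k) :
    pathArr α (Finsupp.single p c) = if p.Extends α then Finsupp.single (p.snoc α) c else 0 := by
  rw [pathArr, Finsupp.lsum_single]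
  split_ifs <;> simp

lemma pathRep : IsRep Q (pathVtx (k := k)) pathArr where
  idem v x := by
    induction x using Finsupp.induction_linear with
    | zero => simp
    | add x y hx hy => simp [hx, hy]
    | single p c => rw [pathVtx_single]; split_ifs with h <;> simp [pathVtx_single, h]
  orth v w x hvw := by
    induction x using Finsupp.induction_linear with
    | zero => simp
    | add x y hx hy => simp [hx, hy]
    | single p c =>
      rw [pathVtx_single]
      split_ifs with h
      · rw [pathVtx_single, if_neg (by rw [h]; exact hvw)]
      · simp
  sum_apply x := by
    classical
    induction x using Finsupp.induction_linear with
    | zero => simp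
    | add x y hx hy => simp [hx, hy, Finset.sum_add_distrib]
    | single p c => simp [pathVtx_single]
  src_apply α x := by
    induction x using Finsupp.induction_linear with
    | zero => simp
    | add x y hx hy => simp [hx, hy]
    | single p c =>
      rw [pathVtx_single]
      split_ifs with h
      · rfl
      · rw [pathArr_single, if_neg fun h' => h h'.end_eq, map_zero]
  tgt_apply α x := by
    induction x using Finsupp.induction_linear with
    | zero => simp
    | add x y hx hy => simp [hx, hy]
    | single p c =>
      rw [pathArr_single]
      split_ifs with h
      · rw [pathVtx_single]
        exact if_pos rfl
      · simp
  rel_apply α β x h := by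
    induction x using Finsupp.induction_linear with
    | zero => simp
    | add x y hx hy => simp [hx, hy]
    | single p c =>
      rw [pathArr_single]
      split_ifs
      · rw [pathArr_single, if_neg fun h' => h'.2 h]
      · simp

/-- The element of the gentle algebra given by a path. -/
noncomputable def pathElt (k : Type u) [Field k] (p : Q.PathCode) : GentleAlg k Q :=
  vtx k p.1 * (p.2.reverse.map (arr k)).prod

lemma pathElt_nil (v : Q.V) : pathElt k (v, []) = vtx k v := by simp [pathElt]

lemma pathElt_snoc (p : Q.PathCode) (α : Q.E) :
    pathElt k (p.snoc α) = pathElt k p * arr k α := by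
  simp [pathElt, PathCode.snoc, mul_assoc]

lemma pathElt_mul_vtx (p : Q.PathCode) : pathElt k p * vtx k p.terminus = pathElt k p := by
  obtain ⟨v, _ | ⟨β, l⟩⟩ := p
  · simp only [pathElt_nil, PathCode.terminus, vtx_mul_self]
  · change pathElt k (PathCode.snoc (v, l) β) * vtx k (Q.tgt β) = pathElt k (PathCode.snoc (v, l) β)
    rw [pathElt_snoc, mul_assoc, arr_mul_vtx_tgt]

/-- The evaluation of combinations of paths in the gentle algebra. -/
noncomputable def pathEval : (Q.PathCode →₀ k) →ₗ[k] GentleAlg k Q :=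
  Finsupp.linearCombination k (pathElt k)

lemma pathEval_single (p : Q.PathCode) (c : k) :
    pathEval (Finsupp.single p c) = c • pathElt k p := by
  simp [pathEval]

lemma pathEval_pathVtx (v : Q.V) (x : Q.PathCode →₀ k) :
    pathEval (pathVtx v x) = pathEval x * vtx k v := by
  induction x using Finsupp.induction_linear with
  | zero => simp
  | add x y hx hy => simp [hx, hy, add_mul]
  | single p c =>
    rw [pathVtx_single]
    split_ifs with h
    · rw [pathEval_single, smul_mul_assoc, ← h, pathElt_mul_vtx]
    · rw [map_zero, pathEval_single, smul_mul_assoc, ← pathElt_mul_vtx, mul_assoc,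
        vtx_mul_of_ne k h]
      simp

lemma pathEval_pathArr (α : Q.E) (x : Q.PathCode →₀ k) :
    pathEval (pathArr α x) = pathEval x * arr k α := by
  induction x using Finsupp.induction_linear with
  | zero => simp
  | add x y hx hy => simp [hx, hy, add_mul]
  | single p c =>
    rw [pathArr_single]
    split_ifs with h
    · rw [pathEval_single, pathEval_single, smul_mul_assoc, pathElt_snoc]
    · rw [map_zero, pathEval_single, smul_mul_assoc]
      by_cases hp : p.terminus = Q.src α
      · obtain ⟨v, _ | ⟨β, l⟩⟩ := p
        · exact absurd hp h
        · have hr : Q.rel β α := by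
            by_contra hr
            exact h ⟨hp, hr⟩
          change 0 = c • (pathElt k (PathCode.snoc (v, l) β) * arr k α)
          rw [pathElt_snoc, mul_assoc, arr_mul_arr k hr]
          simp
      · rw [← pathElt_mul_vtx, ← vtx_src_mul_arr, mul_assoc, ← mul_assoc (vtx k p.terminus),
          vtx_mul_of_ne k hp]
        simp

/-- The combination of paths representing an element of the gentle algebra. -/
noncomputable def pathCoord : GentleAlg k Q →ₗ[k] (Q.PathCode →₀ k) where
  toFun a := pathRep.toAlgHom (op a) (∑ v, Finsupp.single (v, []) 1)
  map_add' a b := by rw [MulOpposite.op_add, map_add]; rfl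
  map_smul' c a := by rw [op_smul, map_smul]; rfl

lemma pathCoord_apply (a : GentleAlg k Q) :
    pathCoord a = pathRep.toAlgHom (op a) (∑ v, Finsupp.single (v, []) 1) := rfl

lemma pathCoord_mul_vtx (a : GentleAlg k Q) (v : Q.V) :
    pathCoord (a * vtx k v) = pathVtx v (pathCoord a) := by
  simp only [pathCoord_apply, op_mul, map_mul, IsRep.toAlgHom_vtx]
  rfl

lemma pathCoord_mul_arr (a : GentleAlg k Q) (α : Q.E) :
    pathCoord (a * arr k α) = pathArr α (pathCoord a) := by
  simp only [pathCoord_apply, op_mul, map_mul, IsRep.toAlgHom_arr]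
  rfl

lemma pathEval_toAlgHom (a : GentleAlg k Q) (x : Q.PathCode →₀ k) :
    pathEval (pathRep.toAlgHom (op a) x) = pathEval x * a := by
  induction a using gentleAlg_induction generalizing x with
  | scalar c =>
    change pathEval (pathRep.toAlgHom (algebraMap k _ c) x) = _
    rw [AlgHom.commutes, Module.algebraMap_end_apply, map_smul, ← Algebra.commutes,
      Algebra.smul_def]
  | vertex v => rw [IsRep.toAlgHom_vtx, pathEval_pathVtx]
  | arrow α => rw [IsRep.toAlgHom_arr, pathEval_pathArr]
  | mul a b iha ihb =>
    rw [op_mul, map_mul, Module.End.mul_apply, ihb, iha, mul_assoc]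
  | add a b iha ihb =>
    rw [MulOpposite.op_add, map_add, LinearMap.add_apply, map_add, iha, ihb, mul_add]

lemma pathEval_pathCoord (a : GentleAlg k Q) : pathEval (pathCoord a) = a := by
  rw [pathCoord_apply, pathEval_toAlgHom]
  simp [pathEval_single, pathElt_nil, sum_vtx]

lemma pathCoord_vtx (v : Q.V) : pathCoord (vtx k v) = Finsupp.single (v, []) 1 := by
  classical
  rw [pathCoord_apply, IsRep.toAlgHom_vtx, map_sum, Finset.sum_eq_single v]
  · rw [pathVtx_single]
    exact if_pos rfl
  · intro w _ hw
    rw [pathVtx_single]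
    exact if_neg hw
  · simp

/-- If an element ending in the source of `α` is killed by `α`, then all its paths end with an
arrow `β` such that `βα` is a relation. -/
lemma exists_rel_of_mul_arr_eq_zero {a : GentleAlg k Q} {α : Q.E}
    (ha : a * vtx k (Q.src α) = a) (h0 : a * arr k α = 0) {p : Q.PathCode}
    (hp : pathCoord a p ≠ 0) : ∃ β q, Q.rel β α ∧ p = PathCode.snoc q β := by
  classical
  have hend : p.terminus = Q.src α := by
    by_contra hne
    apply hp
    rw [← ha, pathCoord_mul_vtx]
    generalize pathCoord a = x
    induction x using Finsupp.induction_linear with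
    | zero => simp
    | add x y hx hy => simp [hx, hy]
    | single q c =>
      rw [pathVtx_single]
      split_ifs with h
      · rw [Finsupp.single_eq_of_ne]
        rintro rfl
        exact hne h
      · rfl
  have hext : ¬ p.Extends α := by
    intro hext
    apply hp
    have h1 : ∀ x : Q.PathCode →₀ k, pathArr α x (p.snoc α) = x p := by
      intro x
      induction x using Finsupp.induction_linear with
      | zero => simp
      | add x y hx hy => simp [hx, hy]
      | single q c =>
        rw [pathArr_single]
        split_ifs with h
        · rw [Finsupp.single_apply, Finsupp.single_apply]
          simp only [(PathCode.snoc_injective α).eq_iff]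
        · rw [Finsupp.single_eq_of_ne]
          · rfl
          · rintro rfl
            exact h hext
    rw [← h1, ← pathCoord_mul_arr, h0]
    simp
  obtain ⟨v, _ | ⟨β, l⟩⟩ := p
  · exact absurd hend hext
  · refine ⟨β, (v, l), ?_, rfl⟩
    by_contra hr
    exact hext ⟨hend, hr⟩

/-- The operation removing the last arrow `β`. -/
noncomputable def stripArr (β : Q.E) : GentleAlg k Q →ₗ[k] GentleAlg k Q :=
  pathEval ∘ₗ Finsupp.lcomapDomain (fun p : Q.PathCode => p.snoc β)
    (PathCode.snoc_injective β) ∘ₗ pathCoord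

lemma stripArr_mul {a : GentleAlg k Q} {α β : Q.E} (hβ : Q.rel β α)
    (ha : a * vtx k (Q.src α) = a) (h0 : a * arr k α = 0) : stripArr β a * arr k β = a := by
  have hx : ∀ p, pathCoord a p ≠ 0 → ∃ q, p = PathCode.snoc q β := by
    intro p hp
    obtain ⟨β', q, hβ', rfl⟩ := exists_rel_of_mul_arr_eq_zero ha h0 hp
    exact ⟨q, by rw [Q.rel_left_unique _ _ _ hβ hβ']⟩
  conv_rhs => rw [← pathEval_pathCoord a]
  rw [stripArr, LinearMap.comp_apply, LinearMap.comp_apply]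
  generalize pathCoord a = x at hx
  have : x = Finsupp.mapDomain (fun p : Q.PathCode => p.snoc β)
      (Finsupp.comapDomain (fun p : Q.PathCode => p.snoc β) x
        (PathCode.snoc_injective β).injOn) := by
    rw [Finsupp.mapDomain_comapDomain _ (PathCode.snoc_injective β)]
    intro p hp
    obtain ⟨q, rfl⟩ := hx p (by simpa using hp)
    exact ⟨q, rfl⟩
  conv_rhs => rw [this]
  change pathEval (Finsupp.comapDomain _ x _) * _ = _
  generalize Finsupp.comapDomain _ x _ = y
  induction y using Finsupp.induction_linear with
  | zero => simp
  | add x y hx hy => simp only [map_add, add_mul, hx, hy, Finsupp.mapDomain_add]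
  | single q c =>
    rw [Finsupp.mapDomain_single, pathEval_single, pathEval_single, pathElt_snoc, smul_mul_assoc]

lemma eq_zero_of_mul_arr_eq_zero {a : GentleAlg k Q} {α : Q.E} (hα : ∀ β, ¬ Q.rel β α)
    (ha : a * vtx k (Q.src α) = a) (h0 : a * arr k α = 0) : a = 0 := by
  rw [← pathEval_pathCoord a]
  have : pathCoord a = 0 := by
    ext p
    by_contra hp
    obtain ⟨β, _, hβ, -⟩ := exists_rel_of_mul_arr_eq_zero ha h0 hp
    exact hα β hβ
  rw [this, map_zero]

/-- In a finite-dimensional gentle algebra there is no infinite walk that avoids relations. -/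
lemma not_exists_infinite_walk (hfd : FiniteDimensional k (GentleAlg k Q)) (w : ℕ → Q.E)
    (hw : ∀ n, Q.tgt (w n) = Q.src (w (n + 1)) ∧ ¬ Q.rel (w n) (w (n + 1))) : False := by
  let path : ℕ → Q.PathCode := fun n =>
    Nat.rec (Q.src (w 0), []) (fun n p => PathCode.snoc p (w n)) n
  have hlen : ∀ n, (path n).2.length = n := by
    intro n
    induction n with
    | zero => rfl
    | succ n ih => simpa [path, PathCode.snoc] using ih
  have hext : ∀ n, (path n).Extends (w n) := by
    intro n
    cases n with
    | zero => exact rfl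
    | succ n => exact hw n
  have hcoord : ∀ n, pathCoord (pathElt k (path n)) = Finsupp.single (path n) 1 := by
    intro n
    induction n with
    | zero => exact (congrArg _ (pathElt_nil _)).trans (pathCoord_vtx _)
    | succ n ih =>
      change pathCoord (pathElt k (PathCode.snoc (path n) (w n))) = _
      rw [pathElt_snoc, pathCoord_mul_arr, ih, pathArr_single, if_pos (hext n)]
  have hinj : Function.Injective path := fun m n h => by rw [← hlen m, ← hlen n, h]
  have hli : LinearIndependent k fun n => pathElt k (path n) := by
    apply LinearIndependent.of_comp pathCoord
    have := (Finsupp.basisSingleOne (R := k) (ι := Q.PathCode)).linearIndependent.comp path hinj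
    convert this using 1
    ext1 n
    simp [hcoord]
  exact Infinite.not_finite (α := ℕ) hli.finite_of_isNoetherian

end Paths

/-! ### Slots -/

variable (Q) in
/-- A distribution of the ends of the arrows over two slots at each vertex, such that a composable
pair of arrows is a relation if and only if the two arrows use the same slot. -/
structure Slotting where
  /-- the slot at the source -/
  srcSide : Q.E → Bool
  /-- the slot at the target -/
  tgtSide : Q.E → Bool
  srcSide_inj : ∀ α β, Q.src α = Q.src β → srcSide α = srcSide β → α = β
  tgtSide_inj : ∀ α β, Q.tgt α = Q.tgt β → tgtSide α = tgtSide β → α = β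
  rel_iff : ∀ α β, Q.rel α β ↔ Q.tgt α = Q.src β ∧ tgtSide α = srcSide β

lemma exists_side {E V : Type*} [Finite E] (f : E → V) (hf : ∀ v, {a : E | f a = v}.ncard ≤ 2) :
    ∃ side : E → Bool, ∀ α β, f α = f β → side α = side β → α = β := by
  have h : ∀ v, ∃ g : {a : E | f a = v} → Bool, Function.Injective g := by
    intro v
    have : Fintype {a : E | f a = v} := Fintype.ofFinite _
    have hc : Fintype.card {a : E | f a = v} ≤ Fintype.card Bool := by
      rw [← Nat.card_eq_fintype_card, Nat.card_coe_set_eq]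
      exact hf v
    exact (Function.Embedding.nonempty_of_card_le hc).elim fun g => ⟨g, g.injective⟩
  choose g hg using h
  refine ⟨fun α => g (f α) ⟨α, rfl⟩, fun α β h1 h2 => ?_⟩
  have : g (f α) ⟨α, rfl⟩ = g (f α) ⟨β, h1.symm⟩ := by
    refine h2.trans ?_
    generalize_proofs p q
    revert p q
    rw [h1]
    intros
    rfl
  simpa using hg _ this

variable (Q) in
lemma exists_slotting : Nonempty Q.Slotting := by
  classical
  obtain ⟨σ, hσ⟩ := exists_side Q.src Q.src_le_two
  obtain ⟨τ₀, hτ₀⟩ := exists_side Q.tgt Q.tgt_le_two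
  have hτ : ∀ α, ∃ t : Bool, (∀ β, Q.tgt α = Q.src β → (Q.rel α β ↔ t = σ β)) ∧
      ((∀ β, Q.tgt α ≠ Q.src β) → t = τ₀ α) := by
    intro α
    by_cases h : ∃ β, Q.tgt α = Q.src β
    · obtain ⟨β, hβ⟩ := h
      refine ⟨if Q.rel α β then σ β else !σ β, fun γ hγ => ?_, fun h' => absurd hβ (h' β)⟩
      by_cases hβγ : β = γ
      · subst hβγ
        by_cases hr : Q.rel α β <;> simp [hr]
      · have hne : σ β ≠ σ γ := fun h => hβγ (hσ _ _ (hβ.symm.trans hγ) h)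
        by_cases hr : Q.rel α β
        · have : ¬ Q.rel α γ := fun hr' => hβγ (Q.rel_right_unique _ _ _ hr hr')
          simp [hr, this, hne]
        · have : Q.rel α γ := by
            by_contra hr'
            exact hβγ (Q.nonrel_right_unique _ _ _ hβ hr hγ hr')
          simp only [this, hr, if_false, true_iff]
          revert hne
          cases σ β <;> cases σ γ <;> simp
    · push Not at h
      exact ⟨τ₀ α, fun β hβ => absurd hβ (h β), fun _ => rfl⟩
  choose τ hτ using hτ
  refine ⟨⟨σ, τ, hσ, fun α β h h' => ?_, fun α β => ⟨fun hr => ?_, fun h => ?_⟩⟩⟩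
  · by_cases hγ : ∃ γ, Q.tgt α = Q.src γ
    · obtain ⟨γ, hγ⟩ := hγ
      have h1 := (hτ α).1 γ hγ
      have h2 := (hτ β).1 γ (h.symm.trans hγ)
      rw [h'] at h1
      by_cases hr : Q.rel α γ
      · exact Q.rel_left_unique _ _ _ hr (h2.2 (h1.1 hr))
      · exact Q.nonrel_left_unique _ _ _ hγ hr (h.symm.trans hγ) fun h => hr (h1.2 (h2.1 h))
    · push Not at hγ
      apply hτ₀ _ _ h
      rw [← (hτ α).2 hγ, ← (hτ β).2 (h ▸ hγ), h']
  · have := Q.rel_comp _ _ hr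
    exact ⟨this, ((hτ α).1 β this).1 hr⟩
  · exact ((hτ α).1 β h.1).2 h.2

namespace Slotting

variable (S : Q.Slotting)

/-- The slot at which an arrow starts. -/
def start (α : Q.E) : Q.V × Bool := (Q.src α, S.srcSide α)

/-- The slot at which an arrow finishes. -/
def finish (α : Q.E) : Q.V × Bool := (Q.tgt α, S.tgtSide α)

lemma start_injective : Function.Injective S.start := fun α β h =>
  S.srcSide_inj α β (congrArg Prod.fst h) (congrArg Prod.snd h)

lemma finish_injective : Function.Injective S.finish := fun α β h =>
  S.tgtSide_inj α β (congrArg Prod.fst h) (congrArg Prod.snd h)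

lemma rel_iff_finish {α β : Q.E} : Q.rel α β ↔ S.finish α = S.start β := by
  rw [S.rel_iff, finish, start, Prod.mk.injEq]

/-- One step along an arrow. -/
def Step (s t : Q.V × Bool) : Prop := ∃ α, S.start α = s ∧ S.finish α = t

lemma Step.left_unique : Relator.LeftUnique S.Step := by
  rintro s t s' ⟨α, rfl, hα⟩ ⟨β, rfl, hβ⟩
  rw [S.finish_injective (hα.trans hβ.symm)]

/-- No arrow starts at the slot. -/
def IsEnd (s : Q.V × Bool) : Prop := ∀ α, S.start α ≠ s

section Exactness

variable (k) {X : Type*} [AddCommGroup X] [Module (GentleAlg k Q)ᵐᵒᵖ X]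

variable (X) in
/-- Exactness of a module at a slot: the kernel of the outgoing arrow is the image of the incoming
arrow, where an absent arrow is zero. -/
def ExactAt (s : Q.V × Bool) : Prop :=
  ∀ x : X, op (vtx k s.1) • x = x → (∀ β, S.start β = s → op (arr k β) • x = 0) →
    x = 0 ∨ ∃ (α : Q.E) (y : X), S.finish α = s ∧ op (arr k α) • y = x

variable {k} {S}

lemma ExactAt.of_retract {Y : Type*} [AddCommGroup Y] [Module (GentleAlg k Q)ᵐᵒᵖ Y]
    {s : Q.V × Bool} (h : S.ExactAt k Y s) (f : X →ₗ[(GentleAlg k Q)ᵐᵒᵖ] Y)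
    (g : Y →ₗ[(GentleAlg k Q)ᵐᵒᵖ] X) (hgf : ∀ x, g (f x) = x) : S.ExactAt k X s := by
  intro x hx hβ
  rcases h (f x) (by rw [← f.map_smul, hx]) (fun β hs => by rw [← f.map_smul, hβ β hs, map_zero])
    with h0 | ⟨α, y, hα, hy⟩
  · left
    rw [← hgf x, h0, map_zero]
  · right
    exact ⟨α, g y, hα, by rw [← g.map_smul, hy, hgf]⟩

lemma exactAt_finsupp (ι : Type*) (γ : Q.E) :
    S.ExactAt k (ι →₀ (GentleAlg k Q)ᵐᵒᵖ) (S.start γ) := by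
  intro x hx hγ
  have h1 : ∀ i, (x i).unop * vtx k (Q.src γ) = (x i).unop := fun i => by
    have := congrArg unop (DFunLike.congr_fun hx i)
    simpa [start] using this
  have h2 : ∀ i, (x i).unop * arr k γ = 0 := fun i => by
    have := congrArg unop (DFunLike.congr_fun (hγ γ rfl) i)
    simpa using this
  by_cases h : ∃ α, Q.rel α γ
  · right
    obtain ⟨α, hα⟩ := h
    refine ⟨α, x.mapRange (fun a => op (stripArr α a.unop)) (by simp), S.rel_iff_finish.1 hα, ?_⟩
    ext i
    apply unop_injective
    simpa using stripArr_mul hα (h1 i) (h2 i)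
  · left
    push Not at h
    ext i
    apply unop_injective
    simpa using eq_zero_of_mul_arr_eq_zero h (h1 i) (h2 i)

variable (X) in
lemma exactAt_of_projective [Module.Projective (GentleAlg k Q)ᵐᵒᵖ X] (γ : Q.E) :
    S.ExactAt k X (S.start γ) := by
  obtain ⟨s, hs⟩ := Module.Projective.out (R := (GentleAlg k Q)ᵐᵒᵖ) (P := X)
  exact (exactAt_finsupp X γ).of_retract s _ hs

lemma exactAt_of_ker {P : Type*} [AddCommGroup P] [Module (GentleAlg k Q)ᵐᵒᵖ P]
    {f : P →ₗ[(GentleAlg k Q)ᵐᵒᵖ] X} (hf : Function.Surjective f) {γ : Q.E}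
    (hP : S.ExactAt k P (S.start γ)) (hK : S.ExactAt k (LinearMap.ker f) (S.finish γ)) :
    S.ExactAt k X (S.start γ) := by
  intro x hx hγ
  obtain ⟨p₀, hp₀⟩ := hf x
  obtain ⟨p, hp⟩ : ∃ p, p = op (vtx k (Q.src γ)) • p₀ := ⟨_, rfl⟩
  have hfp : f p = x := by rw [hp, map_smul, hp₀]; exact hx
  have hep : op (vtx k (Q.src γ)) • p = p := by rw [hp, smul_smul, ← op_mul, vtx_mul_self]
  have hz : op (arr k γ) • p ∈ LinearMap.ker f := by
    rw [LinearMap.mem_ker, map_smul, hfp, hγ γ rfl]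
  obtain ⟨z, hz', hγz⟩ : ∃ z ∈ LinearMap.ker f, op (arr k γ) • p = op (arr k γ) • z := by
    have h1 : op (vtx k (Q.tgt γ)) • (⟨_, hz⟩ : LinearMap.ker f) = ⟨_, hz⟩ := by
      ext
      change op (vtx k (Q.tgt γ)) • op (arr k γ) • p = op (arr k γ) • p
      rw [smul_smul, ← op_mul, arr_mul_vtx_tgt]
    have h2 : ∀ β, S.start β = S.finish γ →
        op (arr k β) • (⟨_, hz⟩ : LinearMap.ker f) = 0 := by
      intro β hβ
      ext
      change op (arr k β) • op (arr k γ) • p = 0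
      rw [smul_smul, ← op_mul, arr_mul_arr k (S.rel_iff_finish.2 hβ.symm)]
      simp
    rcases hK ⟨_, hz⟩ h1 h2 with h0 | ⟨α, y, hα, hy⟩
    · exact ⟨0, zero_mem _, by simpa using h0⟩
    · rw [S.finish_injective hα] at hy
      exact ⟨y, y.2, (congrArg Subtype.val hy).symm⟩
  have hfz : f (p - op (vtx k (Q.src γ)) • z) = x := by
    rw [map_sub, map_smul, LinearMap.mem_ker.1 hz', smul_zero, sub_zero, hfp]
  have h1 : op (vtx k (Q.src γ)) • (p - op (vtx k (Q.src γ)) • z) =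
      p - op (vtx k (Q.src γ)) • z := by
    rw [smul_sub, hep, smul_smul, ← op_mul, vtx_mul_self]
  have h2 : ∀ β, S.start β = S.start γ →
      op (arr k β) • (p - op (vtx k (Q.src γ)) • z) = 0 := by
    intro β hβ
    rw [S.start_injective hβ, smul_sub, smul_smul, ← op_mul, vtx_src_mul_arr, hγz, sub_self]
  rcases hP _ h1 h2 with h0 | ⟨α, y, hα, hy⟩
  · left
    rw [← hfz, h0, map_zero]
  · right
    exact ⟨α, f y, hα, by rw [← f.map_smul, hy, hfz]⟩

/-- A module of finite projective dimension is exact at each slot from which no end can be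
reached. -/
lemma exactAt_of_projDimLE {X : ModuleCat.{u} (GentleAlg k Q)ᵐᵒᵖ} {d : ℕ} (hX : ProjDimLE X d)
    {s : Q.V × Bool} (hs : ∀ t, Relation.ReflTransGen S.Step s t → ¬ S.IsEnd t) :
    S.ExactAt k X s := by
  induction d generalizing X s with
  | zero =>
    have hs' := hs s .refl
    simp only [IsEnd, not_forall, not_not] at hs'
    obtain ⟨γ, rfl⟩ := hs'
    have : Module.Projective (GentleAlg k Q)ᵐᵒᵖ X := hX
    exact exactAt_of_projective X γ
  | succ d ih =>
    have hs' := hs s .refl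
    simp only [IsEnd, not_forall, not_not] at hs'
    obtain ⟨γ, rfl⟩ := hs'
    obtain ⟨P, hP, f, hf, hK⟩ := hX
    exact exactAt_of_ker hf (exactAt_of_projective P γ)
      (ih hK fun t ht => hs t (.head ⟨γ, rfl, rfl⟩ ht))

end Exactness

end Slotting

/-! ### Extensions -/

section Extensions

variable {B : Type u} [Ring B] {X Y P N : ModuleCat.{u} B}

lemma shortExact_of_linearMap {f : Y →ₗ[B] N} {g : N →ₗ[B] X} (hf : Function.Injective f)
    (hg : Function.Surjective g) (hfg : Function.Exact f g) :
    (ShortComplex.mk (ModuleCat.ofHom f) (ModuleCat.ofHom g)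
      (by ext x; exact hfg.apply_apply_eq_zero x)).ShortExact where
  exact := (ShortComplex.ShortExact.moduleCat_exact_iff_function_exact _).2 hfg
  mono_f := (ModuleCat.mono_iff_injective _).2 hf
  epi_g := (ModuleCat.epi_iff_surjective _).2 hg

/-- A short exact sequence splits if the first extension group vanishes. -/
lemma exists_section_of_ext (h : Subsingleton (ExtGroup X Y 1)) {f : Y →ₗ[B] N}
    {g : N →ₗ[B] X} (hf : Function.Injective f) (hg : Function.Surjective g)
    (hfg : Function.Exact f g) : ∃ s : X →ₗ[B] N, ∀ x, g (s x) = x := by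
  let : HasDerivedCategory.{u + 1} (ModuleCat.{u} B) := HasDerivedCategory.standard _
  let : HasExt.{u + 1} (ModuleCat.{u} B) := hasExt_of_hasDerivedCategory _
  have hS := shortExact_of_linearMap hf hg hfg
  obtain ⟨s, hs⟩ := Abelian.Ext.covariant_sequence_exact₃ X hS (Abelian.Ext.mk₀ (𝟙 X))
    (zero_add 1) (h.elim _ _)
  obtain ⟨s, rfl⟩ := Abelian.Ext.addEquiv₀.symm.surjective s
  have hs' : s ≫ ModuleCat.ofHom g = 𝟙 X := by
    apply Abelian.Ext.addEquiv₀.symm.injective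
    simpa using hs
  refine ⟨s.hom, fun x => ?_⟩
  have := congrArg (fun f => f.hom x) hs'
  exact this

/-- Dimension shifting in the first variable. -/
lemma subsingleton_ext_ker (hP : Module.Projective B P) {f : P →ₗ[B] X}
    (hf : Function.Surjective f) {i : ℕ} (hi : Subsingleton (ExtGroup X Y (i + 1 + 1))) :
    Subsingleton (ExtGroup (ModuleCat.of B (LinearMap.ker f)) Y (i + 1)) := by
  let : HasDerivedCategory.{u + 1} (ModuleCat.{u} B) := HasDerivedCategory.standard _
  let : HasExt.{u + 1} (ModuleCat.{u} B) := hasExt_of_hasDerivedCategory _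
  have hS := shortExact_of_linearMap (Y := ModuleCat.of B (LinearMap.ker f))
    (LinearMap.ker f).injective_subtype hf (LinearMap.exact_subtype_ker_map f)
  have hP' : Projective P := by
    have : Projective (ModuleCat.of B P) := (IsProjective.iff_projective (R := B) P).1 hP
    exact this
  refine ⟨fun a b => ?_⟩
  have h0 : ∀ a : Abelian.Ext (ModuleCat.of B (LinearMap.ker f)) Y (i + 1), a = 0 := by
    intro a
    obtain ⟨x, rfl⟩ := Abelian.Ext.contravariant_sequence_exact₁ hS Y a (add_comm 1 (i + 1))
      (hi.elim _ _)
    have := Abelian.Ext.subsingleton_of_projective P Y i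
    rw [Subsingleton.elim x 0]
    simp
  exact (h0 a).trans (h0 b).symm

end Extensions

section RepModule

variable {X : Type*} [AddCommGroup X] [Module k X] {e : Q.V → Module.End k X}
  {f : Q.E → Module.End k X}

/-- The module over the gentle algebra defined by a representation. -/
def RepModule (_ : IsRep Q e f) : Type _ := X

variable (h : IsRep Q e f)

instance : AddCommGroup (RepModule h) := inferInstanceAs (AddCommGroup X)

instance : Module k (RepModule h) := inferInstanceAs (Module k X)

noncomputable instance : Module (GentleAlg k Q)ᵐᵒᵖ (RepModule h) :=
  Module.compHom X h.toAlgHom.toRingHom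

lemma RepModule.smul_def (a : (GentleAlg k Q)ᵐᵒᵖ) (x : RepModule h) :
    a • x = (h.toAlgHom a x : X) := rfl

instance RepModule.isScalarTower : IsScalarTower k (GentleAlg k Q)ᵐᵒᵖ (RepModule h) where
  smul_assoc c a x := by
    rw [RepModule.smul_def, map_smul]
    rfl

/-- The underlying vector space of a representation. -/
def RepModule.equiv : RepModule h ≃ₗ[k] X := LinearEquiv.refl k X

lemma RepModule.equiv_vtx_smul (v : Q.V) (x : RepModule h) :
    RepModule.equiv h (op (vtx k v) • x) = e v (RepModule.equiv h x) := by
  rw [RepModule.smul_def, IsRep.toAlgHom_vtx]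
  rfl

lemma RepModule.equiv_arr_smul (α : Q.E) (x : RepModule h) :
    RepModule.equiv h (op (arr k α) • x) = f α (RepModule.equiv h x) := by
  rw [RepModule.smul_def, IsRep.toAlgHom_arr]
  rfl

end RepModule

section Rigid

variable (X Y : Type*) [AddCommGroup X] [Module k X] [Module (GentleAlg k Q)ᵐᵒᵖ X]
  [AddCommGroup Y] [Module k Y] [Module (GentleAlg k Q)ᵐᵒᵖ Y]
  [IsScalarTower k (GentleAlg k Q)ᵐᵒᵖ X] [IsScalarTower k (GentleAlg k Q)ᵐᵒᵖ Y]

variable (k Q) in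
/-- Every derivation from `X` to `Y` is inner; equivalently, all extensions of `X` by `Y` split. -/
def DerivationsInner : Prop :=
  ∀ D : Q.E → X →ₗ[k] Y, (∀ α x, D α (vact k X (Q.src α) x) = D α x) →
    (∀ α x, vact k Y (Q.tgt α) (D α x) = D α x) →
    (∀ α β x, Q.rel α β → aact k Y β (D α x) + D β (aact k X α x) = 0) →
    ∃ h : X →ₗ[k] Y, (∀ (v : Q.V) x, h (vact k X v x) = vact k Y v (h x)) ∧
      ∀ α x, h (aact k X α x) - aact k Y α (h x) = D α x

variable {X Y}

lemma isRep_extension {D : Q.E → X →ₗ[k] Y} (hs : ∀ α x, D α (vact k X (Q.src α) x) = D α x)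
    (ht : ∀ α x, vact k Y (Q.tgt α) (D α x) = D α x)
    (hr : ∀ α β x, Q.rel α β → aact k Y β (D α x) + D β (aact k X α x) = 0) :
    IsRep Q (fun v => (vact k Y v).prodMap (vact k X v)) (fun α =>
      ((aact k Y α).coprod (D α)).prod (aact k X α ∘ₗ LinearMap.snd k Y X)) where
  idem v x := by ext <;> simp [(isRep k X).idem, (isRep k Y).idem]
  orth v w x h := by ext <;> simp [(isRep k X).orth v w _ h, (isRep k Y).orth v w _ h]
  sum_apply x := by
    ext
    · rw [Prod.fst_sum]; exact (isRep (Q := Q) k Y).sum_apply x.1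
    · rw [Prod.snd_sum]; exact (isRep (Q := Q) k X).sum_apply x.2
  src_apply α x := by ext <;> simp [(isRep k X).src_apply, (isRep k Y).src_apply, hs]
  tgt_apply α x := by ext <;> simp [(isRep k X).tgt_apply, (isRep k Y).tgt_apply, ht]
  rel_apply α β x h := by
    ext <;> simp [(isRep k X).rel_apply _ _ _ h, (isRep k Y).rel_apply _ _ _ h, hr _ _ _ h]

end Rigid

lemma derivationsInner_of_ext {X Y : ModuleCat.{u} (GentleAlg k Q)ᵐᵒᵖ} [Module k X] [Module k Y]
    [IsScalarTower k (GentleAlg k Q)ᵐᵒᵖ X] [IsScalarTower k (GentleAlg k Q)ᵐᵒᵖ Y]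
    (hXY : Subsingleton (ExtGroup X Y 1)) : DerivationsInner k Q X Y := by
  intro D hs ht hr
  have h := isRep_extension hs ht hr
  let f₀ : Y →ₗ[k] RepModule h := (RepModule.equiv h).symm.toLinearMap ∘ₗ LinearMap.inl k Y X
  let g₀ : RepModule h →ₗ[k] X := LinearMap.snd k Y X ∘ₗ (RepModule.equiv h).toLinearMap
  have hf₀ : ∀ y, RepModule.equiv h (f₀ y) = (y, 0) := fun y => by simp [f₀]
  have hg₀ : ∀ z, g₀ z = (RepModule.equiv h z).2 := fun z => rfl
  let f : Y →ₗ[(GentleAlg k Q)ᵐᵒᵖ] RepModule h :=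
    { f₀ with
      map_smul' := map_smul_of_comm f₀
        (fun v y => (RepModule.equiv h).injective <| by
          rw [hf₀, vact_apply k (X := RepModule h), RepModule.equiv_vtx_smul, hf₀]
          simp)
        (fun α y => (RepModule.equiv h).injective <| by
          rw [hf₀, aact_apply k (X := RepModule h), RepModule.equiv_arr_smul, hf₀]
          simp) }
  let g : RepModule h →ₗ[(GentleAlg k Q)ᵐᵒᵖ] X :=
    { g₀ with
      map_smul' := map_smul_of_comm g₀
        (fun v y => by
          rw [hg₀, vact_apply k (X := RepModule h), RepModule.equiv_vtx_smul, hg₀]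
          simp)
        (fun α y => by
          rw [hg₀, aact_apply k (X := RepModule h), RepModule.equiv_arr_smul, hg₀]
          simp) }
  obtain ⟨s, hs⟩ := exists_section_of_ext (N := ModuleCat.of _ (RepModule h)) hXY (f := f) (g := g)
    ((RepModule.equiv h).symm.injective.comp (LinearMap.inl_injective (R := k)))
    ((LinearMap.snd_surjective (R := k)).comp (RepModule.equiv h).surjective)
    (fun z => by
      constructor
      · intro hz
        have hz' : (RepModule.equiv h z).2 = 0 := hz
        refine ⟨(RepModule.equiv h z).1, (RepModule.equiv h).injective ?_⟩
        exact (hf₀ _).trans (Prod.ext rfl hz'.symm)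
      · rintro ⟨y, rfl⟩
        exact congrArg Prod.snd (hf₀ y))
  let s' : X →ₗ[(GentleAlg k Q)ᵐᵒᵖ] RepModule h := s
  let s₀ : X →ₗ[k] Y × X := (RepModule.equiv h).toLinearMap ∘ₗ s'.restrictScalars k
  have hs₀ : ∀ x, (s₀ x).2 = x := hs
  refine ⟨LinearMap.fst k Y X ∘ₗ s₀, fun v x => ?_, fun α x => ?_⟩
  · have := congrArg (RepModule.equiv h) (s'.map_smul (op (vtx k v)) x)
    rw [RepModule.equiv_vtx_smul] at this
    exact congrArg Prod.fst this
  · have := congrArg (RepModule.equiv h) (s'.map_smul (op (arr k α)) x)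
    rw [RepModule.equiv_arr_smul] at this
    have h1 : (s₀ (aact k X α x)).1 = aact k Y α (s₀ x).1 + D α (s₀ x).2 := congrArg Prod.fst this
    rw [hs₀] at h1
    change (s₀ (aact k X α x)).1 - aact k Y α (s₀ x).1 = _
    rw [h1, add_sub_cancel_left]

namespace Slotting

variable {S : Q.Slotting}

lemma exactAt_or_of_derivationsInner {X Y : Type*} [AddCommGroup X] [Module k X]
    [Module (GentleAlg k Q)ᵐᵒᵖ X] [AddCommGroup Y] [Module k Y] [Module (GentleAlg k Q)ᵐᵒᵖ Y]
    [IsScalarTower k (GentleAlg k Q)ᵐᵒᵖ X] [IsScalarTower k (GentleAlg k Q)ᵐᵒᵖ Y]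
    (h : DerivationsInner k Q X Y) (γ : Q.E) :
    S.ExactAt k X (S.start γ) ∨ S.ExactAt k Y (S.finish γ) := by
  classical
  by_contra! hne
  obtain ⟨hX, hY⟩ := hne
  simp only [ExactAt, not_forall, not_or, not_exists, not_and] at hX hY
  obtain ⟨x₀, hx₀, hγ, hx0, hx₁⟩ := hX
  obtain ⟨y₀, hy₀, hβ, -, hy₁⟩ := hY
  obtain ⟨W, hW, hW'⟩ : ∃ W : Submodule k X, x₀ ∉ W ∧
      ∀ α x, S.finish α = S.start γ → aact k X α x ∈ W := by
    by_cases hα : ∃ α, S.finish α = S.start γ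
    · obtain ⟨α, hα⟩ := hα
      refine ⟨LinearMap.range (aact k X α), ?_, fun α' x hα' => ?_⟩
      · rintro ⟨y, hy⟩
        exact hx₁ α y hα hy
      · rw [S.finish_injective (hα'.trans hα.symm)]
        exact ⟨x, rfl⟩
    · exact ⟨⊥, hx0, fun α _ h' => absurd ⟨α, h'⟩ hα⟩
  obtain ⟨l, hl, hWl⟩ := Submodule.exists_le_ker_of_notMem hW
  let D₀ : X →ₗ[k] Y := (l ∘ₗ vact k X (Q.src γ)).smulRight y₀
  let D : Q.E → X →ₗ[k] Y := fun δ => if δ = γ then D₀ else 0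
  have hDγ : D γ = D₀ := if_pos rfl
  have hD : ∀ δ, δ ≠ γ → D δ = 0 := fun δ hδ => if_neg hδ
  have hs : ∀ α x, D α (vact k X (Q.src α) x) = D α x := by
    intro α x
    by_cases hα : α = γ
    · subst hα
      rw [hDγ]
      change l (vact k X _ (vact k X _ x)) • y₀ = l (vact k X _ x) • y₀
      rw [(isRep k X).idem]
    · rw [hD α hα]
      rfl
  have ht : ∀ α x, vact k Y (Q.tgt α) (D α x) = D α x := by
    intro α x
    by_cases hα : α = γ
    · subst hα
      rw [hDγ]
      change vact k Y _ (l (vact k X _ x) • y₀) = l (vact k X _ x) • y₀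
      rw [map_smul]
      congr 1
    · simp [hD α hα]
  have hr : ∀ α β x, Q.rel α β → aact k Y β (D α x) + D β (aact k X α x) = 0 := by
    intro α β x hr
    have hr' := S.rel_iff_finish.1 hr
    have h1 : aact k Y β (D α x) = 0 := by
      by_cases hα : α = γ
      · subst hα
        rw [hDγ]
        change aact k Y β (l (vact k X _ x) • y₀) = 0
        rw [map_smul, aact_apply, hβ β hr'.symm, smul_zero]
      · simp [hD α hα]
    have h2 : D β (aact k X α x) = 0 := by
      by_cases hα : β = γ
      · subst hα
        rw [hDγ]
        change l (vact k X _ (aact k X α x)) • y₀ = 0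
        rw [← Q.rel_comp _ _ hr, (isRep k X).tgt_apply,
          LinearMap.mem_ker.1 (hWl (hW' α x hr')), zero_smul]
      · rw [hD β hα]
        rfl
    rw [h1, h2, add_zero]
  obtain ⟨φ, -, hφ⟩ := h D hs ht hr
  have h1 := hφ γ x₀
  rw [hDγ, aact_apply, hγ γ rfl, map_zero, zero_sub] at h1
  have h2 : D₀ x₀ = l x₀ • y₀ := by
    change l (op (vtx k (Q.src γ)) • x₀) • y₀ = _
    rw [show op (vtx k (Q.src γ)) • x₀ = x₀ from hx₀]
  apply hy₁ γ (-((l x₀)⁻¹ • φ x₀)) rfl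
  rw [← aact_apply, map_neg, map_smul, ← smul_neg, h1, h2, smul_smul, inv_mul_cancel₀ hl, one_smul]

/-- If all higher extensions from `X` to `Y` vanish and `t` comes after `s`, then `X` is exact at
`s` or `Y` is exact at `t`. -/
lemma exactAt_or_of_ext {X Y : ModuleCat.{u} (GentleAlg k Q)ᵐᵒᵖ}
    (h : ∀ i, 0 < i → Subsingleton (ExtGroup X Y i)) {s t : Q.V × Bool}
    (hst : Relation.TransGen S.Step s t) : S.ExactAt k X s ∨ S.ExactAt k Y t := by
  induction hst using Relation.TransGen.head_induction_on generalizing X with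
  | single hs =>
    obtain ⟨γ, rfl, rfl⟩ := hs
    let := Module.restrictScalars k (GentleAlg k Q)ᵐᵒᵖ X
    have := IsScalarTower.restrictScalars k (GentleAlg k Q)ᵐᵒᵖ X
    let := Module.restrictScalars k (GentleAlg k Q)ᵐᵒᵖ Y
    have := IsScalarTower.restrictScalars k (GentleAlg k Q)ᵐᵒᵖ Y
    exact exactAt_or_of_derivationsInner (derivationsInner_of_ext (h 1 one_pos)) γ
  | head hs _ ih =>
    obtain ⟨γ, rfl, rfl⟩ := hs
    obtain ⟨P, hP, f, hf⟩ : ∃ P : ModuleCat.{u} (GentleAlg k Q)ᵐᵒᵖ,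
        Module.Projective (GentleAlg k Q)ᵐᵒᵖ P ∧
          ∃ f : P →ₗ[(GentleAlg k Q)ᵐᵒᵖ] X, Function.Surjective f :=
      ⟨ModuleCat.of _ (X →₀ (GentleAlg k Q)ᵐᵒᵖ),
        inferInstanceAs (Module.Projective _ (X →₀ (GentleAlg k Q)ᵐᵒᵖ)),
        Finsupp.linearCombination _ id, Finsupp.linearCombination_id_surjective _ _⟩
    have hK : ∀ i, 0 < i →
        Subsingleton (ExtGroup (ModuleCat.of (GentleAlg k Q)ᵐᵒᵖ (LinearMap.ker f)) Y i) := by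
      intro i hi
      obtain ⟨i, rfl⟩ := Nat.exists_eq_succ_of_ne_zero hi.ne'
      exact subsingleton_ext_ker hP hf (h _ (Nat.succ_pos _))
    exact (ih hK).imp_left fun hK => exactAt_of_ker hf (exactAt_of_projective P γ) hK

end Slotting

/-! ### Counting dimensions -/

section Counting

namespace Slotting

variable (S : Q.Slotting)

open Classical in
/-- The dimension defect of a dimension vector at a slot. -/
noncomputable def defect (s : Q.V × Bool) : (Q.V ⊕ Q.E → ℚ) →ₗ[ℚ] ℚ :=
  LinearMap.proj (Sum.inl s.1) - ∑ α with S.finish α = s, LinearMap.proj (Sum.inr α) -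
    ∑ α with S.start α = s, LinearMap.proj (Sum.inr α)

open Classical in
lemma defect_apply (s : Q.V × Bool) (x : Q.V ⊕ Q.E → ℚ) :
    S.defect s x = x (Sum.inl s.1) - ∑ α with S.finish α = s, x (Sum.inr α) -
      ∑ α with S.start α = s, x (Sum.inr α) := by
  simp [defect]

open Classical in
lemma defect_vertex (s : Q.V × Bool) (v : Q.V) :
    S.defect s (Pi.single (Sum.inl v) 1) = if s.1 = v then 1 else 0 := by
  simp [defect_apply, Pi.single_apply]

open Classical in
lemma defect_arrow (s : Q.V × Bool) (α : Q.E) :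
    S.defect s (Pi.single (Sum.inr α) 1) =
      -(if S.finish α = s then 1 else 0) - if S.start α = s then 1 else 0 := by
  simp [defect_apply, Pi.single_apply, Finset.sum_ite_eq']

open Classical in
lemma card_isEnd :
    (Finset.univ.filter S.IsEnd).card + Fintype.card Q.E = 2 * Fintype.card Q.V := by
  have h1 : Finset.univ.filter S.IsEnd = (Finset.univ.image S.start)ᶜ := by
    ext s
    simp [IsEnd]
  have h2 : (Finset.univ.image S.start).card = Fintype.card Q.E :=
    Finset.card_image_of_injective _ S.start_injective
  have h3 := Finset.card_add_card_compl (Finset.univ.image S.start)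
  rw [h2, Fintype.card_prod, Fintype.card_bool] at h3
  rw [h1]
  lia

/-- A set of slots that meets each thread with an end at most once, and no other thread, is
contained in one that also meets each thread with an end. -/
lemma exists_transversal {N : Set (Q.V × Bool)}
    (h₁ : ∀ s ∈ N, ∃ t, Relation.ReflTransGen S.Step s t ∧ S.IsEnd t)
    (h₂ : ∀ s ∈ N, ∀ t ∈ N, ¬ Relation.TransGen S.Step s t) :
    ∃ N' : Finset (Q.V × Bool), N ⊆ N' ∧ N'.card + Fintype.card Q.E ≤ 2 * Fintype.card Q.V ∧
      ∀ t, S.IsEnd t → ∃ s ∈ N', Relation.ReflTransGen S.Step s t := by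
  classical
  have hg : ∀ t, ∃ s, Relation.ReflTransGen S.Step s t ∧
      ((∃ s ∈ N, Relation.ReflTransGen S.Step s t) → s ∈ N) := by
    intro t
    by_cases h : ∃ s ∈ N, Relation.ReflTransGen S.Step s t
    · obtain ⟨s, hs, hst⟩ := h
      exact ⟨s, hst, fun _ => hs⟩
    · exact ⟨t, .refl, fun h' => absurd h' h⟩
  choose g hg hgN using hg
  refine ⟨(Finset.univ.filter S.IsEnd).image g, fun s hs => ?_, ?_, fun t ht => ⟨g t, ?_, hg t⟩⟩
  · obtain ⟨t, hst, ht⟩ := h₁ s hs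
    have htN := hgN t ⟨s, hs, hst⟩
    have : s = g t := by
      have hU : Relator.RightUnique (Function.swap S.Step) := fun a b c hab hac =>
        Step.left_unique S hab hac
      have hsw : Relation.ReflTransGen S.Step (g t) s ∨ Relation.ReflTransGen S.Step s (g t) :=
        (Relation.ReflTransGen.total_of_right_unique hU (Relation.reflTransGen_swap.2 hst)
          (Relation.reflTransGen_swap.2 (hg t))).imp Relation.reflTransGen_swap.1
          Relation.reflTransGen_swap.1
      rcases hsw with h | h
      · exact (Relation.reflTransGen_iff_eq_or_transGen.1 h).resolve_right (h₂ _ htN _ hs)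
      · exact ((Relation.reflTransGen_iff_eq_or_transGen.1 h).resolve_right (h₂ _ hs _ htN)).symm
    simp only [Finset.coe_image, Set.mem_image]
    exact ⟨t, by simpa using ht, this.symm⟩
  · have := (Finset.univ.filter S.IsEnd).card_image_le (f := g)
    have := S.card_isEnd
    lia
  · exact Finset.mem_image_of_mem _ (by simpa using ht)

variable {S}

/-- A function on slots that changes sign along arrows and at vertices, and that vanishes somewhere
on each thread with an end, is zero. -/
lemma eq_zero_of_alternating (hfd : FiniteDimensional k (GentleAlg k Q)) {c : Q.V × Bool → ℚ}
    (hV : ∀ v, c (v, true) + c (v, false) = 0) (hE : ∀ α, c (S.finish α) + c (S.start α) = 0)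
    (hend : ∀ t, S.IsEnd t → ∃ s, c s = 0 ∧ Relation.ReflTransGen S.Step s t) (s : Q.V × Bool) :
    c s = 0 := by
  by_contra hs
  have hflip : ∀ v b, c (v, b) ≠ 0 → c (v, !b) ≠ 0 := by
    intro v b hb h0
    apply hb
    cases b
    · simpa [show c (v, true) = 0 from h0] using hV v
    · simpa [show c (v, false) = 0 from h0] using hV v
  have hreach : ∀ s t, Relation.ReflTransGen S.Step s t → c s = 0 → c t = 0 := by
    intro s t hst h0
    induction hst with
    | refl => exact h0
    | tail _ h ih =>
      obtain ⟨α, rfl, rfl⟩ := h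
      simpa [ih] using hE α
  have hout : ∀ s : {s // c s ≠ 0}, ∃ α, S.start α = s := by
    rintro ⟨s, hs⟩
    by_contra! hα
    obtain ⟨t, ht, hts⟩ := hend s hα
    exact hs (hreach _ _ hts ht)
  choose out hout using hout
  have hnext : ∀ s : {s // c s ≠ 0}, c (Q.tgt (out s), !S.tgtSide (out s)) ≠ 0 := by
    intro s
    apply hflip
    intro h0
    have h1 := hE (out s)
    rw [hout, show c (S.finish (out s)) = 0 from h0, zero_add] at h1
    exact s.2 h1
  let w : ℕ → {s // c s ≠ 0} := fun n =>
    Nat.rec ⟨s, hs⟩ (fun _ s => ⟨(Q.tgt (out s), !S.tgtSide (out s)), hnext s⟩) n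
  refine not_exists_infinite_walk hfd (fun n => out (w n)) fun n => ?_
  have h1 : S.start (out (w (n + 1))) = (Q.tgt (out (w n)), !S.tgtSide (out (w n))) := hout _
  refine ⟨(congrArg Prod.fst h1).symm, fun hr => ?_⟩
  have h2 := S.rel_iff_finish.1 hr
  rw [h1] at h2
  simpa [finish] using congrArg Prod.snd h2

/-- More dimension vectors than vertices are linearly dependent if their defects vanish outside a
set that meets each thread with an end at most once, and no other thread. -/
lemma exists_relation (hfd : FiniteDimensional k (GentleAlg k Q)) {N : Set (Q.V × Bool)}
    (h₁ : ∀ s ∈ N, ∃ t, Relation.ReflTransGen S.Step s t ∧ S.IsEnd t)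
    (h₂ : ∀ s ∈ N, ∀ t ∈ N, ¬ Relation.TransGen S.Step s t) {m : ℕ}
    (hm : Fintype.card Q.V < m) (x : Fin m → Q.V ⊕ Q.E → ℚ)
    (hx : ∀ i, ∀ s ∉ N, S.defect s (x i) = 0) :
    ∃ c : Fin m → ℤ, c ≠ 0 ∧ ∑ i, c i • x i = 0 := by
  classical
  obtain ⟨N', hNN', hcard, hend⟩ := S.exists_transversal h₁ h₂
  let L : (Q.V ⊕ Q.E → ℚ) →ₗ[ℚ] ({s // s ∉ N'} → ℚ) := LinearMap.pi fun s => S.defect s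
  have hL : LinearMap.range L = ⊤ := by
    by_contra hne
    obtain ⟨φ, hφ, hle⟩ := Submodule.exists_le_ker_of_lt_top _ (lt_top_iff_ne_top.2 hne)
    have hφL : ∀ z, φ (L z) = 0 := fun z => hle ⟨z, rfl⟩
    let c : Q.V × Bool → ℚ := fun s => if h : s ∉ N' then φ (Pi.single ⟨s, h⟩ 1) else 0
    have hsum : ∀ z, ∑ s, S.defect s z * c s = 0 := by
      intro z
      have h1 : ∀ s ∈ Finset.univ, s ∉ (Finset.univ.filter fun s => s ∉ N') →
          S.defect s z * c s = 0 := by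
        intro s _ hs
        have hs' : s ∈ N' := by simpa using hs
        simp [c, hs']
      rw [← hφL z, LinearMap.pi_apply_eq_sum_univ φ (L z), ← Finset.sum_subset
        (Finset.subset_univ _) h1, ← Finset.sum_subtype_eq_sum_filter, Finset.subtype_univ]
      refine Finset.sum_congr rfl fun s _ => ?_
      have hs : (fun j => if s = j then (1 : ℚ) else 0) = Pi.single s 1 := by
        ext j
        simp [Pi.single_apply, eq_comm]
      rw [hs]
      simp [c, s.2, L]
    have hV : ∀ v, c (v, true) + c (v, false) = 0 := by
      intro v
      have := hsum (Pi.single (Sum.inl v) 1)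
      simpa [defect_vertex, Fintype.sum_prod_type, Finset.sum_add_distrib] using this
    have hE : ∀ α, c (S.finish α) + c (S.start α) = 0 := by
      intro α
      have := hsum (Pi.single (Sum.inr α) 1)
      simp only [defect_arrow, sub_mul, neg_mul, Finset.sum_sub_distrib, Finset.sum_neg_distrib,
        ite_mul, one_mul, zero_mul, Finset.sum_ite_eq, Finset.mem_univ, if_true] at this
      linarith
    have hc := eq_zero_of_alternating hfd hV hE fun t ht => by
      obtain ⟨s, hs, hst⟩ := hend t ht
      exact ⟨s, by simp [c, hs], hst⟩
    apply hφ
    ext s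
    simpa [c, s.2] using hc s
  have hdim : Module.finrank ℚ (LinearMap.ker L) ≤ Fintype.card Q.V := by
    have h3 := LinearMap.finrank_range_add_finrank_ker L
    rw [hL, finrank_top, Module.finrank_fintype_fun_eq_card, Module.finrank_fintype_fun_eq_card,
      Fintype.card_sum, Fintype.card_subtype_compl, Fintype.card_prod, Fintype.card_bool,
      Fintype.card_coe] at h3
    lia
  have hker : ∀ i, x i ∈ LinearMap.ker L := fun i => by
    ext s
    exact hx i s fun hs => s.2 (hNN' hs)
  have hli : ¬ LinearIndependent ℚ x := by
    intro hli
    have h4 : LinearIndependent ℚ (fun i => (⟨x i, hker i⟩ : LinearMap.ker L)) :=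
      LinearIndependent.of_comp (LinearMap.ker L).subtype hli
    have := h4.fintype_card_le_finrank
    rw [Fintype.card_fin] at this
    lia
  rw [← LinearIndependent.iff_fractionRing ℤ ℚ, Fintype.not_linearIndependent_iff] at hli
  obtain ⟨c, hc, i, hi⟩ := hli
  exact ⟨c, fun h => hi (congrFun h i), hc⟩

end Slotting

end Counting

/-! ### Representations with equal dimension vectors -/

section LinearAlgebra

variable {U V V' W : Type*} [AddCommGroup U] [Module k U] [AddCommGroup V] [Module k V]
  [AddCommGroup V'] [Module k V'] [AddCommGroup W] [Module k W]

lemma exists_linearEquiv_comp_eq [FiniteDimensional k V] [FiniteDimensional k V']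
    (h : Module.finrank k V = Module.finrank k V') {u : U →ₗ[k] V} {u' : U →ₗ[k] V'}
    (hu : Function.Injective u) (hu' : Function.Injective u') :
    ∃ φ : V ≃ₗ[k] V', ∀ x, φ (u x) = u' x := by
  obtain ⟨C, hC⟩ := (LinearMap.range u).exists_isCompl
  obtain ⟨C', hC'⟩ := (LinearMap.range u').exists_isCompl
  have h1 := Submodule.finrank_add_eq_of_isCompl hC
  have h2 := Submodule.finrank_add_eq_of_isCompl hC'
  rw [LinearMap.finrank_range_of_inj hu] at h1
  rw [LinearMap.finrank_range_of_inj hu'] at h2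
  let c : C ≃ₗ[k] C' := LinearEquiv.ofFinrankEq _ _ (by lia)
  refine ⟨(Submodule.prodEquivOfIsCompl _ _ hC).symm ≪≫ₗ
    (((LinearEquiv.ofInjective u hu).symm ≪≫ₗ LinearEquiv.ofInjective u' hu').prodCongr c) ≪≫ₗ
    Submodule.prodEquivOfIsCompl _ _ hC', fun x => ?_⟩
  have h3 : (Submodule.prodEquivOfIsCompl _ _ hC).symm (u x) =
      (LinearEquiv.ofInjective u hu x, 0) := by
    rw [LinearEquiv.symm_apply_eq]
    simp
  simp [h3]

lemma exists_linearEquiv_of_complex [FiniteDimensional k V] [FiniteDimensional k V']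
    (h : Module.finrank k V = Module.finrank k V') {u : U →ₗ[k] V} {u' : U →ₗ[k] V'}
    (hu : Function.Injective u) (hu' : Function.Injective u') {p : V →ₗ[k] W} {p' : V' →ₗ[k] W}
    (hp : Function.Surjective p) (hp' : Function.Surjective p') (hpu : ∀ x, p (u x) = 0)
    (hpu' : ∀ x, p' (u' x) = 0) :
    ∃ φ : V ≃ₗ[k] V', (∀ x, φ (u x) = u' x) ∧ ∀ x, p' (φ x) = p x := by
  have h1 := LinearMap.finrank_range_add_finrank_ker p
  have h2 := LinearMap.finrank_range_add_finrank_ker p'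
  rw [LinearMap.range_eq_top.2 hp, finrank_top] at h1
  rw [LinearMap.range_eq_top.2 hp', finrank_top] at h2
  obtain ⟨ψ, hψ⟩ := exists_linearEquiv_comp_eq (k := k) (V := LinearMap.ker p)
    (V' := LinearMap.ker p') (by lia) (u := u.codRestrict _ hpu) (u' := u'.codRestrict _ hpu')
    (fun x y hxy => hu (congrArg Subtype.val hxy)) (fun x y hxy => hu' (congrArg Subtype.val hxy))
  obtain ⟨s, hs⟩ := p.exists_rightInverse_of_surjective (LinearMap.range_eq_top.2 hp)
  obtain ⟨s', hs'⟩ := p'.exists_rightInverse_of_surjective (LinearMap.range_eq_top.2 hp')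
  replace hs := fun x => LinearMap.congr_fun hs x
  replace hs' := fun x => LinearMap.congr_fun hs' x
  simp only [LinearMap.comp_apply, LinearMap.id_apply] at hs hs'
  have hinj : Function.Injective ((LinearMap.ker p).subtype.coprod s) := by
    rw [injective_iff_map_eq_zero]
    rintro ⟨x, w⟩ hx
    simp only [LinearMap.coprod_apply, Submodule.subtype_apply] at hx
    have hw : w = 0 := by simpa [hs] using congrArg p hx
    subst hw
    simpa using hx
  have hinj' : Function.Injective
      (((LinearMap.ker p').subtype.comp ψ.toLinearMap).coprod s') := by
    rw [injective_iff_map_eq_zero]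
    rintro ⟨x, w⟩ hx
    simp only [LinearMap.coprod_apply, LinearMap.comp_apply, Submodule.subtype_apply] at hx
    have hw : w = 0 := by simpa [hs'] using congrArg p' hx
    subst hw
    simpa using hx
  obtain ⟨φ, hφ⟩ := exists_linearEquiv_comp_eq h hinj hinj'
  refine ⟨φ, fun x => ?_, fun x => ?_⟩
  · have := hφ (u.codRestrict _ hpu x, 0)
    simp only [LinearMap.coprod_apply, LinearMap.comp_apply, LinearEquiv.coe_coe, hψ, map_zero,
      add_zero] at this
    exact this
  · have := hφ (⟨x - s (p x), by simp [hs]⟩, p x)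
    simp only [LinearMap.coprod_apply, Submodule.subtype_apply, LinearMap.comp_apply,
      sub_add_cancel] at this
    rw [this]
    simp [hs']

end LinearAlgebra

section DimensionVector

variable (k) (X Y : Type*) [AddCommGroup X] [Module k X] [Module (GentleAlg k Q)ᵐᵒᵖ X]
  [IsScalarTower k (GentleAlg k Q)ᵐᵒᵖ X] [AddCommGroup Y] [Module k Y]
  [Module (GentleAlg k Q)ᵐᵒᵖ Y] [IsScalarTower k (GentleAlg k Q)ᵐᵒᵖ Y]

/-- The dimension vector of a right module: the ranks of all vertex idempotents and arrows. -/
noncomputable def dimVec : Q.V ⊕ Q.E → ℕ :=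
  Sum.elim (fun v => Module.finrank k (LinearMap.range (vact k X v)))
    (fun α => Module.finrank k (LinearMap.range (aact k X α)))

variable {X} in
lemma vact_of_mem {v : Q.V} {x : X} (hx : x ∈ LinearMap.range (vact k X v)) :
    vact k X v x = x := by
  obtain ⟨y, rfl⟩ := hx
  exact (isRep k X).idem v y

lemma aact_mem {v : Q.V} {α : Q.E} (h : Q.tgt α = v) (x : X) :
    aact k X α x ∈ LinearMap.range (vact k X v) :=
  ⟨aact k X α x, by rw [← h, (isRep k X).tgt_apply]⟩

namespace Slotting

variable (S : Q.Slotting) (s : Q.V × Bool)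

open Classical in
/-- The inclusion at a slot of the image of the arrow that ends there. -/
noncomputable def slotIn :
    ((α : {α : Q.E // S.finish α = s}) → LinearMap.range (aact k X α.1)) →ₗ[k]
      LinearMap.range (vact k X s.1) :=
  (∑ α, (Submodule.subtype _).comp (LinearMap.proj α)).codRestrict _ fun x => by
    rw [LinearMap.sum_apply]
    refine Submodule.sum_mem _ fun α _ => ?_
    obtain ⟨y, hy⟩ := (x α).2
    simpa [← hy] using aact_mem k X (congrArg Prod.fst α.2) y

/-- The projection at a slot onto the image of the arrow that starts there. -/
noncomputable def slotOut : LinearMap.range (vact k X s.1) →ₗ[k]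
    ((β : {β : Q.E // S.start β = s}) → LinearMap.range (aact k X β.1)) :=
  LinearMap.pi fun β => (aact k X β.1).rangeRestrict.comp (Submodule.subtype _)

variable {k X S s}

instance : Subsingleton {α : Q.E // S.finish α = s} :=
  ⟨fun a b => Subtype.ext (S.finish_injective (a.2.trans b.2.symm))⟩

instance : Subsingleton {α : Q.E // S.start α = s} :=
  ⟨fun a b => Subtype.ext (S.start_injective (a.2.trans b.2.symm))⟩

lemma coe_slotIn (α : {α : Q.E // S.finish α = s})
    (x : (α : {α : Q.E // S.finish α = s}) → LinearMap.range (aact k X α.1)) :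
    (slotIn k X S s x : X) = x α := by
  classical
  simp [slotIn, Fintype.sum_subsingleton _ α]

lemma coe_slotOut (β : {β : Q.E // S.start β = s}) (x : LinearMap.range (vact k X s.1)) :
    (slotOut k X S s x β : X) = aact k X β.1 x := rfl

lemma slotIn_injective : Function.Injective (slotIn k X S s) := by
  intro x y hxy
  ext α
  rw [← coe_slotIn, ← coe_slotIn, hxy]

lemma slotOut_surjective : Function.Surjective (slotOut k X S s) := by
  intro y
  rcases isEmpty_or_nonempty {β : Q.E // S.start β = s} with h | ⟨⟨β⟩⟩
  · exact ⟨0, Subsingleton.elim _ _⟩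
  · obtain ⟨x, hx⟩ := (y β).2
    refine ⟨⟨vact k X s.1 x, x, rfl⟩, ?_⟩
    ext γ
    obtain rfl := Subsingleton.elim β γ
    rw [coe_slotOut, ← hx, ← (isRep k X).src_apply β.1 x, ← congrArg Prod.fst β.2]
    rfl

lemma slotOut_slotIn (x) : slotOut k X S s (slotIn k X S s x) = 0 := by
  ext β
  rw [coe_slotOut]
  rcases isEmpty_or_nonempty {α : Q.E // S.finish α = s} with h | ⟨⟨α⟩⟩
  · rw [Subsingleton.elim x 0]
    simp
  · obtain ⟨y, hy⟩ := (x α).2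
    rw [coe_slotIn α, ← hy]
    exact (isRep k X).rel_apply _ _ y (S.rel_iff_finish.2 (α.2.trans β.2.symm))

lemma ExactAt.mem_range_slotIn (h : S.ExactAt k X s) {x : LinearMap.range (vact k X s.1)}
    (hx : slotOut k X S s x = 0) : x ∈ LinearMap.range (slotIn k X S s) := by
  have hx' : ∀ β, S.start β = s → op (arr k β) • (x : X) = 0 := fun β hβ =>
    congrArg Subtype.val (congrFun hx ⟨β, hβ⟩)
  rcases h x (vact_of_mem k x.2) hx' with h0 | ⟨α, y, hα, hy⟩
  · exact ⟨0, by ext; simp [h0]⟩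
  · exact ⟨fun γ => (aact k X γ.1).rangeRestrict y, Subtype.ext <| by
      rw [coe_slotIn ⟨α, hα⟩, ← hy]; rfl⟩

open Classical in
/-- The dimension vector of a module has no defect at a slot where the module is exact. -/
lemma ExactAt.defect_dimVec [FiniteDimensional k X] (h : S.ExactAt k X s) :
    S.defect s (fun i => (dimVec k X i : ℚ)) = 0 := by
  have h1 := LinearMap.finrank_range_add_finrank_ker (slotOut k X S s)
  rw [LinearMap.range_eq_top.2 slotOut_surjective, finrank_top] at h1
  have h2 : LinearMap.ker (slotOut k X S s) = LinearMap.range (slotIn k X S s) := by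
    refine le_antisymm (fun x hx => h.mem_range_slotIn hx) ?_
    rintro _ ⟨x, rfl⟩
    exact slotOut_slotIn x
  rw [h2, LinearMap.finrank_range_of_inj slotIn_injective, Module.finrank_pi_fintype,
    Module.finrank_pi_fintype] at h1
  rw [defect_apply, Finset.sum_subtype (p := fun α => S.finish α = s) _ (by simp),
    Finset.sum_subtype (p := fun α => S.start α = s) _ (by simp)]
  simp only [dimVec, Sum.elim_inl, Sum.elim_inr]
  rw [← h1]
  push_cast
  ring

end Slotting

variable {k X Y}

/-- The sum of linear maps between the components of two modules. -/
noncomputable def glue (φ : (v : Q.V) →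
    LinearMap.range (vact k X v) →ₗ[k] LinearMap.range (vact k Y v)) : X →ₗ[k] Y :=
  ∑ v, (Submodule.subtype _).comp ((φ v).comp (vact k X v).rangeRestrict)

lemma vact_glue (φ : (v : Q.V) →
    LinearMap.range (vact k X v) →ₗ[k] LinearMap.range (vact k Y v)) (w : Q.V) (x : X) :
    vact k Y w (glue φ x) = φ w ((vact k X w).rangeRestrict x) := by
  simp only [glue, LinearMap.sum_apply, map_sum, LinearMap.comp_apply, Submodule.subtype_apply]
  rw [Finset.sum_eq_single w]
  · exact vact_of_mem k (Subtype.property _)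
  · intro v _ hv
    rw [← vact_of_mem k (φ v ((vact k X v).rangeRestrict x)).2]
    exact (isRep k Y).orth _ _ _ hv
  · simp

lemma rangeRestrict_coe {v : Q.V} (x : LinearMap.range (vact k X v)) :
    (vact k X v).rangeRestrict x = x :=
  Subtype.ext (vact_of_mem k x.2)

lemma glue_coe (φ : (v : Q.V) →
    LinearMap.range (vact k X v) →ₗ[k] LinearMap.range (vact k Y v)) {w : Q.V}
    (x : LinearMap.range (vact k X w)) : glue φ x = φ w x := by
  rw [← (isRep (Q := Q) k Y).sum_apply (glue φ x), Finset.sum_eq_single w]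
  · rw [vact_glue, rangeRestrict_coe]
  · intro v _ hv
    have : (vact k X v).rangeRestrict x = 0 := by
      ext
      rw [← vact_of_mem k x.2]
      exact (isRep k X).orth _ _ _ hv.symm
    rw [vact_glue, this, map_zero, Submodule.coe_zero]
  · simp

lemma glue_vact (φ : (v : Q.V) →
    LinearMap.range (vact k X v) →ₗ[k] LinearMap.range (vact k Y v)) (w : Q.V) (x : X) :
    glue φ (vact k X w x) = vact k Y w (glue φ x) := by
  rw [vact_glue, ← glue_coe]
  rfl

lemma exists_glue (φ : (v : Q.V) →
    LinearMap.range (vact k X v) ≃ₗ[k] LinearMap.range (vact k Y v)) :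
    ∃ f : X ≃ₗ[k] Y, (∀ (v : Q.V) x, f (vact k X v x) = vact k Y v (f x)) ∧
      ∀ (v : Q.V) (x : LinearMap.range (vact k X v)), f x = φ v x := by
  refine ⟨LinearEquiv.ofLinearMap (glue fun v => (φ v).toLinearMap)
    (glue fun v => (φ v).symm.toLinearMap) ?_ ?_, fun v x => ?_, fun v x => ?_⟩
  · ext y
    rw [← (isRep (Q := Q) k Y).sum_apply (LinearMap.comp _ _ y), LinearMap.id_apply]
    conv_rhs => rw [← (isRep (Q := Q) k Y).sum_apply y]
    refine Finset.sum_congr rfl fun v _ => ?_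
    rw [LinearMap.comp_apply, vact_glue]
    have : (vact k X v).rangeRestrict (glue (fun v => (φ v).symm.toLinearMap) y) =
        (φ v).symm ((vact k Y v).rangeRestrict y) := Subtype.ext (vact_glue _ v y)
    rw [this]
    simp
  · ext y
    rw [← (isRep (Q := Q) k X).sum_apply (LinearMap.comp _ _ y), LinearMap.id_apply]
    conv_rhs => rw [← (isRep (Q := Q) k X).sum_apply y]
    refine Finset.sum_congr rfl fun v _ => ?_
    rw [LinearMap.comp_apply, vact_glue]
    have : (vact k Y v).rangeRestrict (glue (fun v => (φ v).toLinearMap) y) =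
        φ v ((vact k X v).rangeRestrict y) := Subtype.ext (vact_glue _ v y)
    rw [this]
    simp
  · exact glue_vact _ v x
  · exact glue_coe _ x

/-- Two modules with the same dimension vector are isomorphic along threads: there are two linear
isomorphisms such that each arrow is compatible with the appropriate pair of them. -/
lemma Slotting.exists_threadwise_equiv [FiniteDimensional k X] [FiniteDimensional k Y]
    (S : Q.Slotting) (h : dimVec (Q := Q) k X = dimVec k Y) :
    ∃ φ : Bool → (X ≃ₗ[k] Y), (∀ b (v : Q.V) x, φ b (vact k X v x) = vact k Y v (φ b x)) ∧
      ∀ (α : Q.E) x, φ (S.tgtSide α) (aact k X α x) = aact k Y α (φ (S.srcSide α) x) := by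
  have hV : ∀ v, Module.finrank k (LinearMap.range (vact k X v)) =
    Module.finrank k (LinearMap.range (vact k Y v)) := fun v => congrFun h (Sum.inl v)
  let ρ : (α : Q.E) → LinearMap.range (aact k X α) ≃ₗ[k] LinearMap.range (aact k Y α) :=
    fun α => LinearEquiv.ofFinrankEq _ _ (congrFun h (Sum.inr α))
  have hloc : ∀ s : Q.V × Bool, ∃ φ : LinearMap.range (vact k X s.1) ≃ₗ[k]
      LinearMap.range (vact k Y s.1),
      (∀ x, φ (slotIn k X S s x) = slotIn k Y S s (fun α => ρ α.1 (x α))) ∧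
      ∀ x β, slotOut k Y S s (φ x) β = ρ β.1 (slotOut k X S s x β) := by
    intro s
    let a : ((α : {α : Q.E // S.finish α = s}) → LinearMap.range (aact k X α.1)) ≃ₗ[k]
        ((α : {α : Q.E // S.finish α = s}) → LinearMap.range (aact k Y α.1)) :=
      LinearEquiv.piCongrRight fun α => ρ α.1
    let b : ((β : {β : Q.E // S.start β = s}) → LinearMap.range (aact k X β.1)) ≃ₗ[k]
        ((β : {β : Q.E // S.start β = s}) → LinearMap.range (aact k Y β.1)) :=
      LinearEquiv.piCongrRight fun β => ρ β.1
    obtain ⟨φ, hφ₁, hφ₂⟩ := exists_linearEquiv_of_complex (hV s.1)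
      (u := slotIn k X S s) (u' := (slotIn k Y S s).comp a.toLinearMap)
      (p := b.toLinearMap.comp (slotOut k X S s)) (p' := slotOut k Y S s) slotIn_injective
      (slotIn_injective.comp a.injective) (b.surjective.comp slotOut_surjective)
      slotOut_surjective
      (fun x => by rw [LinearMap.comp_apply, slotOut_slotIn, map_zero])
      (fun x => by rw [LinearMap.comp_apply, slotOut_slotIn])
    exact ⟨φ, hφ₁, fun x β => congrFun (hφ₂ x) β⟩
  choose φ hφ₁ hφ₂ using hloc
  choose f hf₁ hf₂ using fun b : Bool => exists_glue (fun v => φ (v, b))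
  refine ⟨f, hf₁, fun α x => ?_⟩
  have h1 : f (S.tgtSide α) (aact k X α x) = ρ α ((aact k X α).rangeRestrict x) := by
    have := hφ₁ (S.finish α) (fun γ => (aact k X γ.1).rangeRestrict x)
    have h3 := congrArg Subtype.val this
    rw [coe_slotIn ⟨α, rfl⟩] at h3
    rw [← h3]
    refine Eq.trans ?_ (hf₂ (S.tgtSide α) (Q.tgt α) _)
    rw [coe_slotIn ⟨α, rfl⟩]
    rfl
  have h2 : aact k Y α (f (S.srcSide α) x) = ρ α ((aact k X α).rangeRestrict x) := by
    have := hφ₂ (S.start α) ((vact k X (Q.src α)).rangeRestrict x) ⟨α, rfl⟩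
    have h3 := congrArg Subtype.val this
    rw [coe_slotOut] at h3
    have h4 : slotOut k X S (S.start α) ((vact k X (Q.src α)).rangeRestrict x) ⟨α, rfl⟩ =
        (aact k X α).rangeRestrict x := Subtype.ext ((isRep k X).src_apply α x)
    rw [h4] at h3
    rw [← h3, ← (isRep k Y).src_apply, ← hf₁]
    exact congrArg _ (hf₂ (S.srcSide α) (Q.src α) ((vact k X (Q.src α)).rangeRestrict x))
  rw [h1, h2]

end DimensionVector

/-! ### Deforming thread-wise isomorphisms -/

section Units

open Polynomial in
/-- In a finite-dimensional algebra `Z` with a linear endomorphism `G`, the equation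
`u + s • G u ∈ k` has an invertible solution `u` for almost all scalars `s`. -/
lemma exists_unit_add_smul {Z : Type*} [Ring Z] [Algebra k Z] [FiniteDimensional k Z]
    (G : Z →ₗ[k] Z) : ∃ D : k[X], D ≠ 0 ∧ ∀ s, D.eval s ≠ 0 →
      ∃ (u : Zˣ) (c : k), (u : Z) + s • G u = c • (1 : Z) := by
  classical
  let b := Module.finBasis k Z
  let A : Matrix (Fin (Module.finrank k Z)) (Fin (Module.finrank k Z)) k[X] :=
    1 + (X : k[X]) • (LinearMap.toMatrix b b G).map C
  let w := A.adjugate.mulVec (fun i => C (b.repr 1 i))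
  let B : Matrix (Fin (Module.finrank k Z)) (Fin (Module.finrank k Z)) k[X] :=
    ∑ i, w i • (Algebra.leftMulMatrix b (b i)).map C
  have hA : ∀ s, (evalRingHom s).mapMatrix A = 1 + s • LinearMap.toMatrix b b G := by
    intro s
    ext i j
    simp [A, Matrix.one_apply, apply_ite (eval s), mul_comm s]
  have hw : ∀ s, (fun i => (w i).eval s) =
      ((1 + s • LinearMap.toMatrix b b G).adjugate).mulVec (b.repr 1) := by
    intro s
    rw [← hA, ← RingHom.map_adjugate]
    ext i
    simp [w, Matrix.mulVec, dotProduct, eval_finsetSum]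
  let u : k → Z := fun s => ∑ i, (w i).eval s • b i
  have hu : ∀ s, b.repr (u s) = fun i => (w i).eval s := by
    intro s
    ext i
    simp [u, Finsupp.single_apply]
  have hB : ∀ s, (evalRingHom s).mapMatrix B = Algebra.leftMulMatrix b (u s) := by
    intro s
    ext i j
    simp [B, u, Matrix.sum_apply]
  refine ⟨A.det * B.det, ?_, fun s hs => ?_⟩
  · intro h0
    have h1 := congrArg (evalRingHom 0) h0
    have h2 : u 0 = 1 := by
      apply b.repr.injective
      ext i
      rw [hu, hw]
      simp
    rw [map_mul, RingHom.map_det, RingHom.map_det, hA, hB, h2] at h1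
    simp at h1
  · have h1 : (evalRingHom s) (A.det * B.det) ≠ 0 := hs
    rw [map_mul, RingHom.map_det, RingHom.map_det, hA, hB] at h1
    have h2 : IsUnit (Algebra.leftMulMatrix b (u s)) :=
      (Matrix.isUnit_iff_isUnit_det _).2 (right_ne_zero_of_mul h1).isUnit
    have h3 : IsUnit (u s) := by
      have h4 : IsUnit (LinearMap.toMatrixAlgEquiv b (Algebra.lmul k Z (u s))) := h2
      rwa [MulEquiv.isUnit_map, Algebra.lmul_isUnit_iff] at h4
    refine ⟨h3.unit, (1 + s • LinearMap.toMatrix b b G).det, ?_⟩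
    rw [IsUnit.unit_spec]
    apply b.repr.injective
    ext i
    have h5 := congrFun (congrArg (Matrix.mulVec (1 + s • LinearMap.toMatrix b b G)) (hw s)) i
    rw [Matrix.mulVec_mulVec, Matrix.mul_adjugate, ← hu, Matrix.add_mulVec, Matrix.one_mulVec,
      Matrix.smul_mulVec, LinearMap.toMatrix_mulVec_repr, Matrix.smul_mulVec, Matrix.one_mulVec]
      at h5
    simpa using h5

open Polynomial in
/-- Two elements with open orbits under the group of units of a subalgebra of `R × R`, acting by
left and right multiplication, lie in the same orbit. -/
lemma exists_unit_eq_mul [Infinite k] {R : Type*} [Ring R] [Algebra k R] [FiniteDimensional k R]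
    (Z : Subalgebra k (Bool → R)) (g : R) (h₁ : ∀ δ, ∃ z ∈ Z, z false - z true = δ)
    (h₂ : ∀ δ, ∃ z ∈ Z, z false * g - g * z true = δ) :
    ∃ u : Zˣ, (u : Z).1 false = g * (u : Z).1 true := by
  have key : ∀ x y : R, (∀ δ, ∃ z ∈ Z, z false * x - x * z true = δ) → ∃ D : k[X], D ≠ 0 ∧
      ∀ s, D.eval s ≠ 0 → ∃ u : Zˣ, (u : Z).1 false * x = (x + s • (y - x)) * (u : Z).1 true := by
    intro x y hx
    let ev : Bool → (Z →ₗ[k] R) := fun b => (LinearMap.proj b).comp Z.val.toLinearMap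
    let L : Z →ₗ[k] R := (LinearMap.mulRight k x).comp (ev false) -
      (LinearMap.mulLeft k x).comp (ev true)
    let N : Z →ₗ[k] R := -(LinearMap.mulLeft k (y - x)).comp (ev true)
    have hL : Function.Surjective L := fun δ => by
      obtain ⟨z, hz, hzδ⟩ := hx δ
      exact ⟨⟨z, hz⟩, hzδ⟩
    obtain ⟨E, hE⟩ := L.exists_rightInverse_of_surjective (LinearMap.range_eq_top.2 hL)
    obtain ⟨D, hD, hDs⟩ := exists_unit_add_smul (E.comp N)
    refine ⟨D, hD, fun s hs => ?_⟩
    obtain ⟨u, c, huc⟩ := hDs s hs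
    refine ⟨u, ?_⟩
    have h := congrArg L huc
    have hLE : L (E (N u)) = N u := LinearMap.congr_fun hE _
    have hL1 : L 1 = 0 := by simp [L, ev]
    rw [map_add, map_smul, LinearMap.comp_apply, hLE, map_smul, hL1, smul_zero] at h
    simp only [L, N, ev, LinearMap.sub_apply, LinearMap.comp_apply, LinearMap.neg_apply,
      LinearMap.mulRight_apply, LinearMap.mulLeft_apply, LinearMap.proj_apply,
      AlgHom.toLinearMap_apply, Subalgebra.coe_val] at h
    rw [add_mul, smul_mul_assoc, ← sub_eq_zero, ← h]
    simp only [smul_neg]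
    abel
  obtain ⟨D₁, hD₁, hs₁⟩ := key 1 g (by simpa using h₁)
  obtain ⟨D₂, hD₂, hs₂⟩ := key g 1 h₂
  have hD₃ : D₂.comp (1 - X) ≠ 0 := by
    intro h
    apply hD₂
    have := congrArg (fun p => p.comp (1 - X)) h
    simpa [comp_assoc] using this
  obtain ⟨s, hs⟩ : ∃ s, (D₁ * D₂.comp (1 - X)).eval s ≠ 0 := by
    by_contra! h
    exact mul_ne_zero hD₁ hD₃ (Polynomial.funext (by simpa using h))
  rw [eval_mul, eval_comp] at hs
  obtain ⟨a, ha⟩ := hs₁ s (left_ne_zero_of_mul hs)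
  obtain ⟨b, hb⟩ := hs₂ (1 - s) (by simpa using right_ne_zero_of_mul hs)
  have hx : g + (1 - s) • (1 - g) = 1 + s • (g - 1) := by
    simp only [sub_smul, smul_sub, one_smul]
    abel
  rw [hx] at hb
  rw [mul_one] at ha
  generalize 1 + s • (g - 1) = x at ha hb
  have e : ∀ i, ((b⁻¹ : Zˣ) : Z).1 i * (b : Z).1 i = 1 := fun i =>
    congrFun (congrArg Subtype.val b.inv_mul) i
  have e' : ∀ i, (b : Z).1 i * ((b⁻¹ : Zˣ) : Z).1 i = 1 := fun i =>
    congrFun (congrArg Subtype.val b.mul_inv) i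
  refine ⟨b⁻¹ * a, ?_⟩
  change ((b⁻¹ : Zˣ) : Z).1 false * (a : Z).1 false = g * (((b⁻¹ : Zˣ) : Z).1 true * (a : Z).1 true)
  calc _ = ((b⁻¹ : Zˣ) : Z).1 false * (x * ((b : Z).1 true * ((b⁻¹ : Zˣ) : Z).1 true) *
        (a : Z).1 true) := by rw [ha, e', mul_one]
    _ = ((b⁻¹ : Zˣ) : Z).1 false * ((x * (b : Z).1 true) * (((b⁻¹ : Zˣ) : Z).1 true *
        (a : Z).1 true)) := by simp only [mul_assoc]
    _ = (((b⁻¹ : Zˣ) : Z).1 false * (b : Z).1 false) * (g * (((b⁻¹ : Zˣ) : Z).1 true *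
        (a : Z).1 true)) := by rw [← hb]; simp only [mul_assoc]
    _ = _ := by rw [e, one_mul]

end Units

section Deformation

variable (k) (X Y : Type*) [AddCommGroup X] [Module k X] [Module (GentleAlg k Q)ᵐᵒᵖ X]
  [IsScalarTower k (GentleAlg k Q)ᵐᵒᵖ X] [AddCommGroup Y] [Module k Y]
  [Module (GentleAlg k Q)ᵐᵒᵖ Y] [IsScalarTower k (GentleAlg k Q)ᵐᵒᵖ Y]

/-- The linear endomorphisms of a right module that preserve all vertex components. -/
noncomputable def vertexEnd : Subalgebra k (Module.End k X) :=
  Subalgebra.centralizer k (Set.range (vact (Q := Q) k X))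

variable {k X} in
lemma mem_vertexEnd {δ : Module.End k X} :
    δ ∈ vertexEnd (Q := Q) k X ↔ ∀ (v : Q.V) x, δ (vact k X v x) = vact k X v (δ x) := by
  simp only [vertexEnd, Subalgebra.mem_centralizer_iff, Set.forall_mem_range, LinearMap.ext_iff]
  exact forall₂_congr fun v x => eq_comm

namespace Slotting

variable (S : Q.Slotting)

/-- The thread-wise endomorphisms of a right module: pairs of vertex-preserving linear
endomorphisms, one for each side, that are compatible with all arrows. -/
noncomputable def threadEnd : Subalgebra k (Bool → vertexEnd (Q := Q) k X) where
  carrier := {z | ∀ (α : Q.E) x, (z (S.tgtSide α)).1 (aact k X α x) =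
    aact k X α ((z (S.srcSide α)).1 x)}
  mul_mem' {a b} ha hb α x := by
    change (a _).1 ((b _).1 _) = aact k X α ((a _).1 ((b _).1 _))
    rw [hb, ha]
  add_mem' {a b} ha hb α x := by
    change (a _).1 _ + (b _).1 _ = aact k X α ((a _).1 _ + (b _).1 _)
    rw [hb, ha, map_add]
  algebraMap_mem' c α x := by
    change c • aact k X α x = aact k X α (c • x)
    rw [map_smul]

variable {k X Y S}

lemma mem_threadEnd {z : Bool → vertexEnd (Q := Q) k X} :
    z ∈ S.threadEnd k X ↔ ∀ (α : Q.E) x, (z (S.tgtSide α)).1 (aact k X α x) =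
      aact k X α ((z (S.srcSide α)).1 x) := Iff.rfl

lemma exists_mem_threadEnd_sub (h : DerivationsInner k Q X X) (δ : vertexEnd (Q := Q) k X) :
    ∃ z ∈ S.threadEnd k X, z false - z true = δ := by
  have hδ := mem_vertexEnd.1 δ.2
  let D : Q.E → X →ₗ[k] X := fun α =>
    (if S.tgtSide α then δ.1.comp (aact k X α) else 0) -
      if S.srcSide α then (aact k X α).comp δ.1 else 0
  have hD : ∀ α x, D α x = (if S.tgtSide α then δ.1 (aact k X α x) else 0) -
      if S.srcSide α then aact k X α (δ.1 x) else 0 := by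
    intro α x
    simp only [D, LinearMap.sub_apply]
    split_ifs <;> simp
  obtain ⟨f, hf, hfD⟩ := h D
    (fun α x => by rw [hD, hD, hδ, (isRep k X).src_apply, (isRep k X).src_apply])
    (fun α x => by
      rw [hD, map_sub]
      congr 1 <;> split_ifs <;> simp [← hδ, (isRep k X).tgt_apply])
    (fun α β x hr => by
      have hside : S.tgtSide α = S.srcSide β := congrArg Prod.snd (S.rel_iff_finish.1 hr)
      have h0 := fun y => (isRep k X).rel_apply α β y hr
      rw [hD, hD, hside, h0]
      cases S.srcSide β <;> cases S.srcSide α <;> simp [h0])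
  have hf' := mem_vertexEnd.2 hf
  refine ⟨fun b => if b then ⟨f, hf'⟩ - δ else ⟨f, hf'⟩, mem_threadEnd.2 fun α x => ?_, by simp⟩
  have h1 := hfD α x
  rw [hD] at h1
  cases hs : S.srcSide α <;> cases ht : S.tgtSide α <;> simp [hs, ht] at h1 ⊢ <;>
    grind

/-- Modules with the same dimension vector and without outer derivations are isomorphic. -/
theorem nonempty_linearEquiv [Infinite k] [FiniteDimensional k X] [FiniteDimensional k Y]
    (S : Q.Slotting) (hX : DerivationsInner k Q X X) (hY : DerivationsInner k Q Y Y)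
    (h : dimVec (Q := Q) k X = dimVec k Y) : Nonempty (X ≃ₗ[(GentleAlg k Q)ᵐᵒᵖ] Y) := by
  obtain ⟨φ, hφv, hφ⟩ := S.exists_threadwise_equiv h
  have hφv' : ∀ b (v : Q.V) y, (φ b).symm (vact k Y v y) = vact k X v ((φ b).symm y) := by
    intro b v y
    rw [LinearEquiv.symm_apply_eq, hφv, LinearEquiv.apply_symm_apply]
  have hφ' : ∀ (α : Q.E) y, (φ (S.tgtSide α)).symm (aact k Y α y) =
      aact k X α ((φ (S.srcSide α)).symm y) := by
    intro α y
    rw [LinearEquiv.symm_apply_eq, hφ, LinearEquiv.apply_symm_apply]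
  have hg : ((φ true).trans (φ false).symm).toLinearMap ∈ vertexEnd (Q := Q) k X :=
    mem_vertexEnd.2 fun v x => by simp [hφv, hφv']
  obtain ⟨u, hu⟩ := exists_unit_eq_mul (S.threadEnd k X) ⟨_, hg⟩ (exists_mem_threadEnd_sub hX) (by
    intro δ
    have hδ := mem_vertexEnd.1 δ.2
    have hδ' : (φ false).toLinearMap.comp (δ.1.comp (φ true).symm.toLinearMap) ∈
        vertexEnd (Q := Q) k Y := mem_vertexEnd.2 fun v y => by simp [hφv, hφv', hδ]
    obtain ⟨w, hw, hwδ⟩ := exists_mem_threadEnd_sub hY ⟨_, hδ'⟩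
    have hwv := fun b => mem_vertexEnd.1 (w b).2
    have hz : ∀ b, (φ b).symm.toLinearMap.comp ((w b).1.comp (φ b).toLinearMap) ∈
        vertexEnd (Q := Q) k X := fun b => mem_vertexEnd.2 fun v x => by simp [hφv, hφv', hwv]
    refine ⟨fun b => ⟨_, hz b⟩, fun α x => ?_, Subtype.ext (LinearMap.ext fun x => ?_)⟩
    · simp only [LinearMap.comp_apply, LinearEquiv.coe_coe]
      rw [hφ, hw, hφ']
    · have h1 := LinearMap.congr_fun (congrArg Subtype.val hwδ) (φ true x)
      simp only [AddSubgroupClass.coe_sub, LinearMap.sub_apply, LinearMap.comp_apply,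
        LinearEquiv.coe_coe, LinearEquiv.symm_apply_apply] at h1
      simp only [AddSubgroupClass.coe_sub, LinearMap.sub_apply, MulMemClass.coe_mul,
        Module.End.mul_apply, LinearMap.comp_apply, LinearEquiv.coe_coe, LinearEquiv.trans_apply,
        LinearEquiv.apply_symm_apply]
      rw [← map_sub, h1, LinearEquiv.symm_apply_apply])
  have e : ∀ x, ((u : S.threadEnd k X).1 false).1 ((((u⁻¹ : (S.threadEnd k X)ˣ) :
      S.threadEnd k X).1 false).1 x) = x := fun x =>
    LinearMap.congr_fun (congrArg Subtype.val (congrFun (congrArg Subtype.val u.mul_inv) false)) x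
  have e' : ∀ x, (((u⁻¹ : (S.threadEnd k X)ˣ) : S.threadEnd k X).1 false).1
      (((u : S.threadEnd k X).1 false).1 x) = x := fun x =>
    LinearMap.congr_fun (congrArg Subtype.val (congrFun (congrArg Subtype.val u.inv_mul) false)) x
  let θ : X ≃ₗ[k] X := LinearEquiv.ofLinearMap _ _ (LinearMap.ext e) (LinearMap.ext e')
  let ψ : X ≃ₗ[k] Y := θ.trans (φ false)
  have hψ : ∀ b x, ψ x = φ b (((u : S.threadEnd k X).1 b).1 x) := by
    intro b x
    cases b with
    | false => rfl
    | true =>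
      have h1 : ((u : S.threadEnd k X).1 false).1 x =
          (φ false).symm (φ true (((u : S.threadEnd k X).1 true).1 x)) :=
        LinearMap.congr_fun (congrArg Subtype.val hu) x
      change φ false (((u : S.threadEnd k X).1 false).1 x) = _
      rw [h1, LinearEquiv.apply_symm_apply]
  have hψs := map_smul_of_comm ψ.toLinearMap
    (fun v x => by
      simp only [LinearEquiv.coe_coe, hψ false]
      rw [mem_vertexEnd.1 (Subtype.property _), hφv])
    (fun α x => by
      simp only [LinearEquiv.coe_coe]
      rw [hψ (S.tgtSide α), u.1.2 α x, hφ, ← hψ])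
  exact ⟨{ ψ with map_smul' := hψs }⟩

end Slotting

end Deformation

/-! ### Decompositions into indecomposable modules -/

section KrullSchmidt

variable {B : Type u} [Ring B]

lemma isUnit_or_isNilpotent_of_isIndec {X : ModuleCat.{u} B} (hX : IsIndec X) [IsArtinian B X]
    [IsNoetherian B X] (a : Module.End B X) : IsUnit a ∨ IsNilpotent a := by
  obtain ⟨n, hn⟩ := Filter.eventually_atTop.1 a.eventually_isCompl_ker_pow_range_pow
  have hc := hn (n + 1) (by lia)
  rcases hX.2 (ModuleCat.of B (LinearMap.ker (a ^ (n + 1))))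
    (ModuleCat.of B (LinearMap.range (a ^ (n + 1))))
    ⟨(Submodule.prodEquivOfIsCompl _ _ hc).symm⟩ with h | h
  · left
    have h1 : Function.Injective (a ^ (n + 1)) :=
      LinearMap.ker_eq_bot.1 ((Submodule.subsingleton_iff_eq_bot).1 h)
    have h2 : Function.Injective a := by
      rw [pow_succ] at h1
      exact Function.Injective.of_comp h1
    exact (Module.End.isUnit_iff a).2 (IsArtinian.bijective_of_injective_endomorphism a h2)
  · right
    exact ⟨n + 1, LinearMap.range_eq_bot.1 ((Submodule.subsingleton_iff_eq_bot).1 h)⟩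

lemma exists_isUnit_of_isUnit_sum {R ι : Type*} [Ring R] (h : ∀ a : R, IsUnit a ∨ IsNilpotent a)
    [Nontrivial R] (a : ι → R) (s : Finset ι) (hs : IsUnit (∑ i ∈ s, a i)) :
    ∃ i ∈ s, IsUnit (a i) := by
  classical
  induction s using Finset.induction_on with
  | empty => simp at hs
  | insert j s hj ih =>
    rw [Finset.sum_insert hj] at hs
    obtain ⟨u, hu⟩ := hs
    rcases h (↑u⁻¹ * a j) with h1 | h1
    · exact ⟨j, Finset.mem_insert_self j s, (Units.isUnit_units_mul _ _).1 h1⟩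
    · have h2 := h1.isUnit_one_sub
      have h3 : 1 - ↑u⁻¹ * a j = ↑u⁻¹ * ∑ i ∈ s, a i := by
        rw [sub_eq_iff_eq_add', ← mul_add, ← hu, Units.inv_mul]
      rw [h3] at h2
      obtain ⟨i, hi, hia⟩ := ih ((Units.isUnit_units_mul _ _).1 h2)
      exact ⟨i, Finset.mem_insert_of_mem hi, hia⟩

lemma nonempty_linearEquiv_of_retract {X Y : ModuleCat.{u} B} [Nontrivial X] (hY : IsIndec Y)
    (f : X →ₗ[B] Y) (r : Y →ₗ[B] X) (h : ∀ x, r (f x) = x) : Nonempty (X ≃ₗ[B] Y) := by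
  let e : Y ≃ₗ[B] X × LinearMap.ker r := LinearEquiv.ofLinearMap
    (r.prod ((LinearMap.id - f.comp r).codRestrict _ fun y => by simp [h]))
    (f.coprod (LinearMap.ker r).subtype)
    (by ext x <;> simp [h]) (by ext y; simp)
  rcases hY.2 X (ModuleCat.of B (LinearMap.ker r)) ⟨e⟩ with h1 | h1
  · exact absurd h1 (not_subsingleton X)
  · have hr : Function.Injective r :=
      LinearMap.ker_eq_bot.1 ((Submodule.subsingleton_iff_eq_bot).1 h1)
    exact ⟨(LinearEquiv.ofBijective r ⟨hr, fun x => ⟨f x, h x⟩⟩).symm⟩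

/-- An indecomposable module of finite length that is a direct summand of a finite direct sum of
indecomposable modules is isomorphic to one of them. -/
lemma exists_linearEquiv_of_retract_pi {X : ModuleCat.{u} B} (hX : IsIndec X) [IsArtinian B X]
    [IsNoetherian B X] {J : Type*} [Fintype J] {Y : J → ModuleCat.{u} B} (hY : ∀ q, IsIndec (Y q))
    (f : X →ₗ[B] ((q : J) → Y q)) (g : ((q : J) → Y q) →ₗ[B] X) (h : ∀ x, g (f x) = x) :
    ∃ q, Nonempty (X ≃ₗ[B] Y q) := by
  classical
  have := hX.1
  let a : J → Module.End B X := fun q =>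
    (g.comp (LinearMap.single B (fun q => Y q) q)).comp ((LinearMap.proj q).comp f)
  have ha : ∑ q, a q = 1 := by
    ext x
    simp only [a, LinearMap.sum_apply, LinearMap.comp_apply, ← map_sum]
    rw [Module.End.one_apply]
    conv_rhs => rw [← h x, ← Finset.univ_sum_single (f x)]
    rfl
  obtain ⟨q, -, hq⟩ := exists_isUnit_of_isUnit_sum (isUnit_or_isNilpotent_of_isIndec hX) a
    Finset.univ (by rw [ha]; exact isUnit_one)
  obtain ⟨u, hu⟩ := hq
  refine ⟨q, nonempty_linearEquiv_of_retract (hY q) ((LinearMap.proj q).comp f)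
    ((↑u⁻¹ : Module.End B X).comp (g.comp (LinearMap.single B (fun q => Y q) q))) fun x => ?_⟩
  have h1 := LinearMap.congr_fun u.inv_mul x
  rw [hu] at h1
  exact h1

/-- There is no nontrivial isomorphism between direct sums of copies of pairwise non-isomorphic
indecomposable modules of finite length. -/
lemma eq_zero_of_linearEquiv_pi {ι : Type} [Fintype ι] {N : ι → ModuleCat.{u} B}
    [∀ i, IsArtinian B (N i)] [∀ i, IsNoetherian B (N i)] (hN : ∀ i, IsIndec (N i))
    (hne : ∀ i j, i ≠ j → IsEmpty (N i ≃ₗ[B] N j)) {c : ι → ℤ}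
    (φ : ((p : Σ i, Fin (c i).toNat) → N p.1) ≃ₗ[B] ((p : Σ i, Fin (-c i).toNat) → N p.1)) :
    c = 0 := by
  classical
  ext i
  rw [Pi.zero_apply]
  by_contra hi
  rcases lt_or_gt_of_ne hi with h | h
  · let p : Σ i, Fin (-c i).toNat := ⟨i, 0, by lia⟩
    obtain ⟨q, ⟨e⟩⟩ := exists_linearEquiv_of_retract_pi (X := N i) (hN i)
      (Y := fun p : Σ i, Fin (c i).toNat => N p.1) (fun _ => hN _)
      (φ.symm.toLinearMap.comp (LinearMap.single B (fun p : Σ i, Fin (-c i).toNat => N p.1) p))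
      ((LinearMap.proj p).comp φ.toLinearMap) (fun x => by simp [p])
    have : 0 < (c q.1).toNat := q.2.pos
    exact (hne i q.1 (by rintro rfl; lia)).false e
  · let p : Σ i, Fin (c i).toNat := ⟨i, 0, by lia⟩
    obtain ⟨q, ⟨e⟩⟩ := exists_linearEquiv_of_retract_pi (X := N i) (hN i)
      (Y := fun p : Σ i, Fin (-c i).toNat => N p.1) (fun _ => hN _)
      (φ.toLinearMap.comp (LinearMap.single B (fun p : Σ i, Fin (c i).toNat => N p.1) p))
      ((LinearMap.proj p).comp φ.symm.toLinearMap) (fun x => by simp [p])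
    have : 0 < (-c q.1).toNat := q.2.pos
    exact (hne i q.1 (by rintro rfl; lia)).false e

end KrullSchmidt

/-! ### Direct sums of summands of a rigid module -/

section Assembly

section Pi

variable {J : Type*} [Fintype J] {X : J → Type*} [∀ j, AddCommGroup (X j)] [∀ j, Module k (X j)]

lemma finrank_range_pi [∀ j, FiniteDimensional k (X j)] {F : ((j : J) → X j) →ₗ[k] (j : J) → X j}
    {f : ∀ j, X j →ₗ[k] X j} (h : ∀ x j, F x j = f j (x j)) :
    Module.finrank k (LinearMap.range F) = ∑ j, Module.finrank k (LinearMap.range (f j)) := by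
  let g : ((j : J) → LinearMap.range (f j)) →ₗ[k] (j : J) → X j :=
    LinearMap.pi fun j => (Submodule.subtype _).comp (LinearMap.proj j)
  have hg : Function.Injective g := fun x y hxy => funext fun j => Subtype.ext (congrFun hxy j)
  have h1 : LinearMap.range F = LinearMap.range g := by
    apply le_antisymm
    · rintro _ ⟨x, rfl⟩
      exact ⟨fun j => (f j).rangeRestrict (x j), funext fun j => (h x j).symm⟩
    · rintro _ ⟨x, rfl⟩
      choose y hy using fun j => (x j).2
      exact ⟨y, funext fun j => (h y j).trans (hy j)⟩
  rw [h1, LinearMap.finrank_range_of_inj hg, Module.finrank_pi_fintype]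

lemma dimVec_pi [∀ j, Module (GentleAlg k Q)ᵐᵒᵖ (X j)]
    [∀ j, IsScalarTower k (GentleAlg k Q)ᵐᵒᵖ (X j)] [∀ j, FiniteDimensional k (X j)] :
    dimVec (Q := Q) k ((j : J) → X j) = ∑ j, dimVec k (X j) := by
  ext i
  rw [Finset.sum_apply]
  cases i with
  | inl v => exact finrank_range_pi fun x j => rfl
  | inr α => exact finrank_range_pi fun x j => rfl

end Pi

/-- If `X` is a direct summand of a finite direct sum of copies of `T`, and all derivations of `T`
are inner, then so are those of `X`. -/
lemma DerivationsInner.of_retract {T X : Type*} [AddCommGroup T] [Module k T]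
    [Module (GentleAlg k Q)ᵐᵒᵖ T] [IsScalarTower k (GentleAlg k Q)ᵐᵒᵖ T] [AddCommGroup X]
    [Module k X] [Module (GentleAlg k Q)ᵐᵒᵖ X] [IsScalarTower k (GentleAlg k Q)ᵐᵒᵖ X]
    (hT : DerivationsInner k Q T T) {J : Type*} [Fintype J] (f : J → X →ₗ[(GentleAlg k Q)ᵐᵒᵖ] T)
    (g : J → T →ₗ[(GentleAlg k Q)ᵐᵒᵖ] X) (hgf : ∀ x, ∑ j, g j (f j x) = x) :
    DerivationsInner k Q X X := by
  intro D hs ht hr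
  let f' : J → X →ₗ[k] T := fun j => (f j).restrictScalars k
  let g' : J → T →ₗ[k] X := fun j => (g j).restrictScalars k
  have key : ∀ p q, ∃ h : T →ₗ[k] T, (∀ (v : Q.V) x, h (vact k T v x) = vact k T v (h x)) ∧
      ∀ α x, h (aact k T α x) - aact k T α (h x) = f p (D α (g q x)) := by
    intro p q
    refine hT (fun α => (f' p).comp ((D α).comp (g' q))) (fun α x => ?_) (fun α x => ?_)
      (fun α β x hαβ => ?_)
    · change f p (D α (g q _)) = f p (D α (g q x))
      rw [map_vact, hs]
    · change vact k T _ (f p (D α (g q x))) = f p (D α (g q x))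
      rw [← map_vact, ht]
    · change aact k T β (f p (D α (g q x))) + f p (D β (g q _)) = 0
      rw [map_aact k (g q), ← map_aact k (f p), ← map_add, hr α β _ hαβ, map_zero]
  choose h hv hD using key
  refine ⟨∑ p, ∑ q, (g' p).comp ((h p q).comp (f' q)), fun v x => ?_, fun α x => ?_⟩
  · simp only [LinearMap.sum_apply, map_sum]
    refine Finset.sum_congr rfl fun p _ => Finset.sum_congr rfl fun q _ => ?_
    change g p (h p q (f q _)) = vact k X v (g p (h p q (f q x)))
    rw [map_vact, hv, map_vact]
  · have h1 : ∀ p q, g p (h p q (f q (aact k X α x))) - aact k X α (g p (h p q (f q x))) =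
        g p (f p (D α (g q (f q x)))) := by
      intro p q
      rw [map_aact k (f q), ← map_aact k (g p), ← map_sub, hD]
    simp only [LinearMap.sum_apply, map_sum, ← Finset.sum_sub_distrib]
    calc _ = ∑ p, ∑ q, g p (f p (D α (g q (f q x)))) :=
          Finset.sum_congr rfl fun p _ => Finset.sum_congr rfl fun q _ => h1 p q
      _ = D α x := by
          rw [Finset.sum_comm]
          simp only [hgf, ← map_sum]

section Summands

variable {M : Type*} [AddCommGroup M] [Module k M] [Module (GentleAlg k Q)ᵐᵒᵖ M]
  [IsScalarTower k (GentleAlg k Q)ᵐᵒᵖ M] {ι : Type*} {N : ι → Type*}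
  [∀ i, AddCommGroup (N i)] [∀ i, Module k (N i)] [∀ i, Module (GentleAlg k Q)ᵐᵒᵖ (N i)]
  [∀ i, IsScalarTower k (GentleAlg k Q)ᵐᵒᵖ (N i)]

open Classical in
lemma DerivationsInner.pi (hM : DerivationsInner k Q M M)
    (e : M ≃ₗ[(GentleAlg k Q)ᵐᵒᵖ] ((i : ι) → N i)) {J : Type*} [Fintype J] (σ : J → ι) :
    DerivationsInner k Q ((j : J) → N (σ j)) ((j : J) → N (σ j)) :=
  hM.of_retract (J := J)
    (fun j => e.symm.toLinearMap.comp ((LinearMap.single _ N (σ j)).comp (LinearMap.proj j)))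
    (fun j => (LinearMap.single _ (fun j => N (σ j)) j).comp
      ((LinearMap.proj (σ j)).comp e.toLinearMap))
    (fun x => by
      simpa using Finset.univ_sum_single x)

/-- A linear relation between the dimension vectors of the summands of a rigid module lifts to an
isomorphism. -/
lemma Slotting.nonempty_linearEquiv_pi [Infinite k] [Fintype ι] [∀ i, FiniteDimensional k (N i)]
    (S : Q.Slotting) (hM : DerivationsInner k Q M M)
    (e : M ≃ₗ[(GentleAlg k Q)ᵐᵒᵖ] ((i : ι) → N i)) {c : ι → ℤ}
    (hc : ∑ i, c i • (fun t => (dimVec (Q := Q) k (N i) t : ℚ)) = 0) :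
    Nonempty (((p : Σ i, Fin (c i).toNat) → N p.1) ≃ₗ[(GentleAlg k Q)ᵐᵒᵖ]
      ((p : Σ i, Fin (-c i).toNat) → N p.1)) := by
  refine S.nonempty_linearEquiv (hM.pi e _) (hM.pi e _) ?_
  rw [dimVec_pi, dimVec_pi]
  ext t
  have hs : ∀ a : ι → ℕ, ∑ p : Σ i, Fin (a i), dimVec (Q := Q) k (N p.1) t =
      ∑ i, a i * dimVec k (N i) t := by
    intro a
    rw [Fintype.sum_sigma]
    refine Finset.sum_congr rfl fun i _ => (Finset.sum_const (dimVec k (N i) t)).trans ?_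
    rw [Finset.card_univ, Fintype.card_fin, smul_eq_mul]
  rw [Finset.sum_apply, Finset.sum_apply, hs, hs]
  have h := congrFun hc t
  simp only [Finset.sum_apply, Pi.smul_apply, Pi.zero_apply] at h
  simp only [zsmul_eq_mul] at h
  have h2 : ∑ i, (c i) * (dimVec (Q := Q) k (N i) t : ℤ) = 0 := by exact_mod_cast h
  zify
  rw [← sub_eq_zero, ← Finset.sum_sub_distrib, ← h2]
  refine Finset.sum_congr rfl fun i _ => ?_
  rw [← sub_mul, Int.toNat_sub_toNat_neg]

end Summands

end Assembly

section Bound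

lemma not_card_lt_of_isIndecDecomp [Infinite k] (hfd : FiniteDimensional k (GentleAlg k Q))
    {M : ModuleCat.{u} (GentleAlg k Q)ᵐᵒᵖ} (hMfin : Module.Finite (GentleAlg k Q)ᵐᵒᵖ M)
    (hM : IsPreTilting M) {m : ℕ} {N : Fin m → ModuleCat.{u} (GentleAlg k Q)ᵐᵒᵖ}
    (hN : IsIndecDecomp M N) : ¬ Fintype.card Q.V < m := by
  intro hm
  obtain ⟨⟨d, hd⟩, hself⟩ := hM
  obtain ⟨hind, hne, ⟨e⟩⟩ := hN
  obtain ⟨S⟩ := exists_slotting Q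
  let := Module.restrictScalars k (GentleAlg k Q)ᵐᵒᵖ M
  have := IsScalarTower.restrictScalars k (GentleAlg k Q)ᵐᵒᵖ M
  let := fun i => Module.restrictScalars k (GentleAlg k Q)ᵐᵒᵖ (N i)
  have := fun i => IsScalarTower.restrictScalars k (GentleAlg k Q)ᵐᵒᵖ (N i)
  have hretract : ∀ i x, (LinearMap.proj i ∘ₗ e.toLinearMap)
      ((e.symm.toLinearMap ∘ₗ LinearMap.single (GentleAlg k Q)ᵐᵒᵖ (fun i => N i) i) x) = x :=
    fun i x => by simp
  have hNfin : ∀ i, FiniteDimensional k (N i) := fun i => by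
    have : Module.Finite (GentleAlg k Q)ᵐᵒᵖ (N i) :=
      Module.Finite.of_surjective (LinearMap.proj i ∘ₗ e.toLinearMap) fun x => ⟨_, hretract i x⟩
    have : Module.Finite k (GentleAlg k Q)ᵐᵒᵖ := Module.Finite.equiv (opLinearEquiv k)
    exact Module.Finite.trans (GentleAlg k Q)ᵐᵒᵖ (N i)
  have hart := fun i => isArtinian_of_tower (M := N i) (S := (GentleAlg k Q)ᵐᵒᵖ) k inferInstance
  have hnoe := fun i => isNoetherian_of_tower (M := N i) (S := (GentleAlg k Q)ᵐᵒᵖ) k inferInstance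
  obtain ⟨c, hc, hsum⟩ := S.exists_relation hfd (N := {s | ¬ S.ExactAt k M s})
    (fun s hs => by
      by_contra! h
      exact hs (Slotting.exactAt_of_projDimLE hd h))
    (fun s hs t ht hst => (Slotting.exactAt_or_of_ext hself hst).elim hs ht) hm
    (fun i t => (dimVec (Q := Q) k (N i) t : ℚ))
    (fun i s hs => (Slotting.ExactAt.of_retract (not_not.1 hs) _ _ (hretract i)).defect_dimVec)
  obtain ⟨φ⟩ := S.nonempty_linearEquiv_pi (derivationsInner_of_ext (hself 1 one_pos)) e hsum
  exact hc (eq_zero_of_linearEquiv_pi hind hne φ)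

end Bound

end GentleQuiverData

end

/-- A (multiplicity-free) pre-tilting module over a gentle algebra of rank `n`
has at most `n` pairwise non-isomorphic indecomposable direct summands. -/
theorem pretilting_rank_le
    (k : Type u) [Field k] [IsAlgClosed k]
    (Q : GentleQuiverData.{u}) (n : ℕ)
    (hfd : FiniteDimensional k (GentleAlg k Q))
    (hrank : Fintype.card Q.V = n)
    (M : ModuleCat.{u} (GentleAlg k Q)ᵐᵒᵖ)
    (hMfin : Module.Finite (GentleAlg k Q)ᵐᵒᵖ M)
    (hMpre : IsPreTilting M) :
    ∀ m : ℕ, HasRank M m → m ≤ n := by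
  rintro m ⟨N, hN⟩
  exact hrank ▸ not_lt.1 (GentleQuiverData.not_card_lt_of_isIndecDecomp hfd hMfin hMpre hN)
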